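/- arXiv:2310.02336 — 3 statements merged into one kernel-verified Lean document; each statement's English description precedes it below -/
import Mathlib

section
/- Let G be a triangle-free finite simple graph with at least 2 vertices. Then G is 1-HNG if and only if one of the following holds: (1) there exist two distinct nonadjacent vertices u, v such that every edge of G has exactly one endpoint in {u, v} (G is a subgraph of K_{2,n−2}); (2) there exist two distinct vertices u, v such that every edge of G is incident to u or to v and no vertex other than u and v is adjacent to both u and v (G is a subgraph of a double star); or (3) there exist vertices c1,...,c5 inducing a 5-cycle with edges exactly c1c2, c2c3, c3c4, c4c5, c1c5 such that all remaining vertices are pairwise nonadjacent and each remaining vertex has neighborhood equal to one of ∅, {c1}, {c1,c3}, {c1,c4} (G is in family D3, possibly with isolated vertices). -/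
open SimpleGraph

/-- The chromatic number of `G` as a natural number. -/
noncomputable def chi {V : Type*} (G : SimpleGraph V) : ℕ := G.chromaticNumber.toNat

/-- The clique cover number of `G`: the chromatic number of the complement. -/
noncomputable def theta {V : Type*} (G : SimpleGraph V) : ℕ := chi Gᶜ

/-- `G` is `a`-hereditary-Nordhaus-Gaddum: every induced subgraph `H`
satisfies `χ(H) + θ(H) ≥ |H| + 1 - a`. -/
def IsHNG {V : Type*} [Fintype V] (G : SimpleGraph V) (a : ℕ) : Prop :=
  ∀ s : Finset V, s.card + 1 - a ≤ chi (G.induce (s : Set V)) + theta (G.induce (s : Set V))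

section Coloring

variable {V : Type*}

theorem chi_le_of_colorable {H : SimpleGraph V} {n : ℕ} (h : H.Colorable n) : chi H ≤ n :=
  ENat.toNat_le_of_le_natCast h.chromaticNumber_le

theorem colorable_chi [Finite V] (H : SimpleGraph V) : H.Colorable (chi H) := by
  have := Fintype.ofFinite V
  exact colorable_chromaticNumber H.colorable_of_fintype

/-- A clique cover is injective off a vertex cover, so it has at least `|s| - |C|` classes. -/
theorem card_le_theta_add_card_cover (G : SimpleGraph V) (s C : Finset V)
    (hC : ∀ a ∈ s, ∀ b ∈ s, G.Adj a b → a ∈ C ∨ b ∈ C) :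
    s.card ≤ theta (G.induce (s : Set V)) + C.card := by
  classical
  obtain ⟨f⟩ := colorable_chi (G.induce (s : Set V))ᶜ
  have hinj : (s.attach.filter fun x => x.1 ∉ C).card ≤ theta (G.induce (s : Set V)) := by
    rw [← Fintype.card_fin (theta (G.induce (s : Set V))), ← Finset.card_univ]
    refine Finset.card_le_card_of_injOn f (fun _ _ => Finset.mem_univ _) ?_
    intro x hx y hy hxy
    by_contra hne
    have hx' := (Finset.mem_filter.1 (Finset.mem_coe.1 hx)).2
    have hy' := (Finset.mem_filter.1 (Finset.mem_coe.1 hy)).2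
    refine f.valid (v := x) (w := y) ⟨hne, fun h => ?_⟩ hxy
    exact (hC x x.2 y y.2 h).elim hx' hy'
  have hcover : (s.attach.filter fun x => ¬ x.1 ∉ C).card ≤ C.card := by
    refine Finset.card_le_card_of_injOn Subtype.val ?_ Subtype.val_injective.injOn
    intro x hx
    simpa using hx
  have := Finset.card_filter_add_card_filter_not (s := s.attach) (fun x => x.1 ∉ C)
  rw [Finset.card_attach] at this
  omega

theorem two_le_chi_of_adj (G : SimpleGraph V) (s : Finset V) {a b : V} (ha : a ∈ s)
    (hb : b ∈ s) (hab : G.Adj a b) : 2 ≤ chi (G.induce (s : Set V)) := by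
  by_contra! h
  obtain ⟨f⟩ := (colorable_chi (G.induce (s : Set V))).mono (Nat.le_of_lt_succ h)
  exact f.valid (v := ⟨a, ha⟩) (w := ⟨b, hb⟩) hab (Subsingleton.elim _ _)

theorem card_le_chi_add_theta_of_pair_cover (G : SimpleGraph V) (s : Finset V) (u v : V)
    (hC : ∀ a ∈ s, ∀ b ∈ s, G.Adj a b → a = u ∨ a = v ∨ b = u ∨ b = v) :
    s.card ≤ chi (G.induce (s : Set V)) + theta (G.induce (s : Set V)) := by
  classical
  by_cases h : ∃ a ∈ s, ∃ b ∈ s, G.Adj a b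
  · obtain ⟨a, ha, b, hb, hab⟩ := h
    have h1 := two_le_chi_of_adj G s ha hb hab
    have h2 := card_le_theta_add_card_cover G s {u, v} fun a ha b hb hab => by
      have := hC a ha b hb hab
      simp only [Finset.mem_insert, Finset.mem_singleton]
      tauto
    have h3 : ({u, v} : Finset V).card ≤ 2 := Finset.card_le_two
    omega
  · push Not at h
    have := card_le_theta_add_card_cover G s ∅ fun a ha b hb hab => (h a ha b hb hab).elim
    simp only [Finset.card_empty] at this
    omega

end Coloring

section FiveCycle

variable {V : Type*} {G : SimpleGraph V}

/-- The vertices `c1, …, c5` form a closed walk of length five. -/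
structure IsFiveCycle (G : SimpleGraph V) (c1 c2 c3 c4 c5 : V) : Prop where
  e12 : G.Adj c1 c2
  e23 : G.Adj c2 c3
  e34 : G.Adj c3 c4
  e45 : G.Adj c4 c5
  e15 : G.Adj c1 c5

theorem IsFiveCycle.rotate {c1 c2 c3 c4 c5 : V} (h : IsFiveCycle G c1 c2 c3 c4 c5) :
    IsFiveCycle G c2 c3 c4 c5 c1 :=
  ⟨h.e23, h.e34, h.e45, h.e15.symm, h.e12.symm⟩

theorem IsFiveCycle.three_le_chi {c1 c2 c3 c4 c5 : V} (h : IsFiveCycle G c1 c2 c3 c4 c5)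
    (s : Finset V) (h1 : c1 ∈ s) (h2 : c2 ∈ s) (h3 : c3 ∈ s) (h4 : c4 ∈ s) (h5 : c5 ∈ s) :
    3 ≤ chi (G.induce (s : Set V)) := by
  by_contra! hlt
  obtain ⟨f⟩ := (colorable_chi (G.induce (s : Set V))).mono (Nat.le_of_lt_succ hlt)
  have e12 := f.valid (v := ⟨c1, h1⟩) (w := ⟨c2, h2⟩) h.e12
  have e23 := f.valid (v := ⟨c2, h2⟩) (w := ⟨c3, h3⟩) h.e23
  have e34 := f.valid (v := ⟨c3, h3⟩) (w := ⟨c4, h4⟩) h.e34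
  have e45 := f.valid (v := ⟨c4, h4⟩) (w := ⟨c5, h5⟩) h.e45
  have e15 := f.valid (v := ⟨c1, h1⟩) (w := ⟨c5, h5⟩) h.e15
  omega

/-- `CliqueFree 3` unfolded to adjacencies. -/
def TriangleFree (G : SimpleGraph V) : Prop :=
  ∀ a b c, G.Adj a b → G.Adj b c → ¬ G.Adj a c

theorem triangleFree_of_cliqueFree (h : G.CliqueFree 3) : TriangleFree G := by
  classical
  intro a b c hab hbc hac
  exact h {a, b, c} (is3Clique_triple_iff.2 ⟨hab, hac, hbc⟩)

/-- No six distinct vertices induce a bipartite graph with the perfect matching `aᵢbᵢ`. -/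
def NoBipartiteThreeMatching (G : SimpleGraph V) : Prop :=
  ∀ a1 b1 a2 b2 a3 b3 : V, [a1, b1, a2, b2, a3, b3].Nodup →
    G.Adj a1 b1 → G.Adj a2 b2 → G.Adj a3 b3 →
    G.Adj a1 a2 ∨ G.Adj a1 a3 ∨ G.Adj a2 a3 ∨ G.Adj b1 b2 ∨ G.Adj b1 b3 ∨ G.Adj b2 b3

theorem IsHNG.noBipartiteThreeMatching [Fintype V] (h : IsHNG G 1) :
    NoBipartiteThreeMatching G := by
  classical
  intro a1 b1 a2 b2 a3 b3 hd e1 e2 e3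
  by_contra! hno
  obtain ⟨n1, n2, n3, n4, n5, n6⟩ := hno
  have hs := h [a1, b1, a2, b2, a3, b3].toFinset
  rw [List.toFinset_card_of_nodup hd] at hs
  set s := [a1, b1, a2, b2, a3, b3].toFinset with hs_def
  have hmem : ∀ x : (s : Set V), x.1 = a1 ∨ x.1 = b1 ∨ x.1 = a2 ∨ x.1 = b2 ∨ x.1 = a3 ∨
      x.1 = b3 := by
    rintro ⟨x, hx⟩
    simpa [hs_def] using hx
  simp only [List.nodup_cons, List.mem_cons, List.not_mem_nil, not_or, or_false] at hd
  have hchi : chi (G.induce (s : Set V)) ≤ 2 := by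
    refine chi_le_of_colorable ⟨Coloring.mk
      (fun x => if x.1 = a1 ∨ x.1 = a2 ∨ x.1 = a3 then (0 : Fin 2) else 1) ?_⟩
    rintro x y hxy
    have hxy' : G.Adj x.1 y.1 := hxy
    have hx := hmem x
    have hy := hmem y
    have := hxy'.symm
    have := hxy'.ne
    grind [G.adj_comm]
  have htheta : theta (G.induce (s : Set V)) ≤ 3 := by
    refine chi_le_of_colorable ⟨Coloring.mk
      (fun x => if x.1 = a1 ∨ x.1 = b1 then (0 : Fin 3) else
        if x.1 = a2 ∨ x.1 = b2 then 1 else 2) ?_⟩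
    rintro x y ⟨hne, hxy⟩
    have hne' : x.1 ≠ y.1 := fun h => hne (Subtype.ext h)
    have hxy' : ¬ G.Adj x.1 y.1 := hxy
    have hx := hmem x
    have hy := hmem y
    grind [G.adj_comm]
  simp only [List.length_cons, List.length_nil] at hs
  omega

theorem exists_isFiveCycle_of_threeMatching_of_adj (ht : TriangleFree G)
    (hb : NoBipartiteThreeMatching G) {a1 b1 a2 b2 a3 b3 : V}
    (hd : [a1, b1, a2, b2, a3, b3].Nodup)
    (e1 : G.Adj a1 b1) (e2 : G.Adj a2 b2) (e3 : G.Adj a3 b3) (e : G.Adj a1 a2) :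
    ∃ c1 c2 c3 c4 c5, IsFiveCycle G c1 c2 c3 c4 c5 := by
  by_contra! hno
  have hno' : ∀ c1 c2 c3 c4 c5, G.Adj c1 c2 → G.Adj c2 c3 → G.Adj c3 c4 → G.Adj c4 c5 →
      ¬ G.Adj c1 c5 := fun _ _ _ _ _ h1 h2 h3 h4 h5 => hno _ _ _ _ _ ⟨h1, h2, h3, h4, h5⟩
  have h1 := hb a1 b1 b2 a2 a3 b3 (by grind) e1 e2.symm e3
  have h2 := hb b1 a1 a2 b2 a3 b3 (by grind) e1.symm e2 e3
  have n1 := ht b2 a2 a1 e2.symm e.symm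
  have n2 := ht b1 a1 a2 e1.symm e
  have := e1.symm
  have := e2.symm
  have := e3.symm
  have := e.symm
  have h1' : G.Adj a1 a3 ∨ G.Adj b2 a3 ∨ G.Adj b1 b3 ∨ G.Adj a2 b3 := by
    grind [G.adj_comm]
  have h2' : G.Adj b1 a3 ∨ G.Adj a2 a3 ∨ G.Adj a1 b3 ∨ G.Adj b2 b3 := by
    grind [G.adj_comm]
  clear h1 h2
  rcases h1' with h1 | h1 | h1 | h1 <;> rcases h2' with h2 | h2 | h2 | h2 <;>
    have := h1.symm <;> have := h2.symm <;> grind [TriangleFree]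

theorem exists_isFiveCycle_of_threeMatching (ht : TriangleFree G)
    (hb : NoBipartiteThreeMatching G) {a1 b1 a2 b2 a3 b3 : V}
    (hd : [a1, b1, a2, b2, a3, b3].Nodup)
    (e1 : G.Adj a1 b1) (e2 : G.Adj a2 b2) (e3 : G.Adj a3 b3) :
    ∃ c1 c2 c3 c4 c5, IsFiveCycle G c1 c2 c3 c4 c5 := by
  rcases hb a1 b1 a2 b2 a3 b3 hd e1 e2 e3 with h | h | h | h | h | h
  · exact exists_isFiveCycle_of_threeMatching_of_adj ht hb hd e1 e2 e3 h
  · exact exists_isFiveCycle_of_threeMatching_of_adj ht hb (by grind) e1 e3 e2 h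
  · exact exists_isFiveCycle_of_threeMatching_of_adj ht hb (by grind) e2 e3 e1 h
  · exact exists_isFiveCycle_of_threeMatching_of_adj ht hb (by grind) e1.symm e2.symm e3 h
  · exact exists_isFiveCycle_of_threeMatching_of_adj ht hb (by grind) e1.symm e3.symm e2 h
  · exact exists_isFiveCycle_of_threeMatching_of_adj ht hb (by grind) e2.symm e3.symm e1 h

theorem exists_isFiveCycle_of_maximal_matching (ht : TriangleFree G)
    (hb : NoBipartiteThreeMatching G)
    (hcov : ∀ u v : V, ∃ a b, G.Adj a b ∧ a ≠ u ∧ a ≠ v ∧ b ≠ u ∧ b ≠ v)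
    {a1 b1 a2 b2 : V} (hd : [a1, b1, a2, b2].Nodup) (e1 : G.Adj a1 b1) (e2 : G.Adj a2 b2)
    (hmax : ∀ x y, G.Adj x y → x ∈ [a1, b1, a2, b2] ∨ y ∈ [a1, b1, a2, b2])
    (h1 : ∀ x, G.Adj b1 x → x ∈ [a1, b1, a2, b2])
    (h2 : ∀ x, G.Adj b2 x → x ∈ [a1, b1, a2, b2]) :
    ∃ c1 c2 c3 c4 c5, IsFiveCycle G c1 c2 c3 c4 c5 := by
  have hb12 : G.Adj b1 b2 := by
    obtain ⟨x, y, hxy, _⟩ := hcov a1 a2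
    have := hxy.symm
    have := hxy.ne
    grind
  have n1 := ht a1 b1 b2 e1 hb12
  have n2 := ht a2 b2 b1 e2 hb12.symm
  obtain ⟨x, hx, hxo⟩ : ∃ x, G.Adj a1 x ∧ x ∉ [a1, b1, a2, b2] := by
    by_contra! h
    obtain ⟨x, y, hxy, _⟩ := hcov a2 b1
    have := hxy.symm
    have := hxy.ne
    grind
  obtain ⟨y, hy, hyo⟩ : ∃ y, G.Adj a2 y ∧ y ∉ [a1, b1, a2, b2] := by
    by_contra! h
    obtain ⟨x, y, hxy, _⟩ := hcov a1 b2
    have := hxy.symm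
    have := hxy.ne
    grind
  by_cases hxy : x = y
  · subst hxy
    exact ⟨x, a1, b1, b2, a2, hx.symm, e1, hb12, e2.symm, hy.symm⟩
  · exact exists_isFiveCycle_of_threeMatching ht hb (a1 := a1) (b1 := x) (a2 := b1) (b2 := b2)
      (a3 := a2) (b3 := y) (by grind) hx hb12 hy

theorem exists_isFiveCycle (ht : TriangleFree G) (hb : NoBipartiteThreeMatching G) [Nonempty V]
    (hcov : ∀ u v : V, ∃ a b, G.Adj a b ∧ a ≠ u ∧ a ≠ v ∧ b ≠ u ∧ b ≠ v) :
    ∃ c1 c2 c3 c4 c5, IsFiveCycle G c1 c2 c3 c4 c5 := by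
  obtain ⟨v⟩ := ‹Nonempty V›
  obtain ⟨a1, b1, e1, -⟩ := hcov v v
  obtain ⟨a2, b2, e2, hd1⟩ := hcov a1 b1
  have := e1.ne
  have := e2.ne
  by_cases hmax : ∀ x y, G.Adj x y → x ∈ [a1, b1, a2, b2] ∨ y ∈ [a1, b1, a2, b2]
  swap
  · push Not at hmax
    obtain ⟨x, y, hxy, hx, hy⟩ := hmax
    have := hxy.ne
    exact exists_isFiveCycle_of_threeMatching ht hb (a1 := a1) (b1 := b1) (a2 := a2) (b2 := b2)
      (a3 := x) (b3 := y) (by grind) e1 e2 hxy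
  by_cases h1 : (∀ x, G.Adj a1 x → x ∈ [a1, b1, a2, b2]) ∨
      ∀ x, G.Adj b1 x → x ∈ [a1, b1, a2, b2]
  swap
  · push Not at h1
    obtain ⟨⟨x, hx, hxo⟩, y, hy, hyo⟩ := h1
    have hxy : x ≠ y := by rintro rfl; exact ht _ _ _ e1 hy hx
    exact exists_isFiveCycle_of_threeMatching ht hb (a1 := a1) (b1 := x) (a2 := b1) (b2 := y)
      (a3 := a2) (b3 := b2) (by grind) hx hy e2
  by_cases h2 : (∀ x, G.Adj a2 x → x ∈ [a1, b1, a2, b2]) ∨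
      ∀ x, G.Adj b2 x → x ∈ [a1, b1, a2, b2]
  swap
  · push Not at h2
    obtain ⟨⟨x, hx, hxo⟩, y, hy, hyo⟩ := h2
    have hxy : x ≠ y := by rintro rfl; exact ht _ _ _ e2 hy hx
    exact exists_isFiveCycle_of_threeMatching ht hb (a1 := a1) (b1 := b1) (a2 := a2) (b2 := x)
      (a3 := b2) (b3 := y) (by grind) e1 hx hy
  rcases h1 with h1 | h1 <;> rcases h2 with h2 | h2
  · exact exists_isFiveCycle_of_maximal_matching ht hb hcov (a1 := b1) (b1 := a1) (a2 := b2)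
      (b2 := a2) (by grind) e1.symm e2.symm (by grind) (by grind) (by grind)
  · exact exists_isFiveCycle_of_maximal_matching ht hb hcov (a1 := b1) (b1 := a1) (a2 := a2)
      (b2 := b2) (by grind) e1.symm e2 (by grind) (by grind) (by grind)
  · exact exists_isFiveCycle_of_maximal_matching ht hb hcov (a1 := a1) (b1 := b1) (a2 := b2)
      (b2 := a2) (by grind) e1 e2.symm (by grind) (by grind) (by grind)
  · exact exists_isFiveCycle_of_maximal_matching ht hb hcov (a1 := a1) (b1 := b1) (a2 := a2)
      (b2 := b2) (by grind) e1 e2 (by grind) (by grind) (by grind)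

namespace IsFiveCycle

variable {c1 c2 c3 c4 c5 w w' : V}

theorem not_adj_of_dist_two (h : IsFiveCycle G c1 c2 c3 c4 c5) (ht : TriangleFree G) :
    ¬ G.Adj c1 c3 :=
  ht _ _ _ h.e12 h.e23

theorem nodup (h : IsFiveCycle G c1 c2 c3 c4 c5) (ht : TriangleFree G) :
    [c1, c2, c3, c4, c5].Nodup := by
  have h13 : c1 ≠ c3 := by rintro rfl; exact ht _ _ _ h.e34 h.e45 h.e15
  have h24 : c2 ≠ c4 := by rintro rfl; exact ht _ _ _ h.e45 h.e15.symm h.e12.symm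
  have h35 : c3 ≠ c5 := by rintro rfl; exact ht _ _ _ h.e12 h.e23 h.e15
  have h14 : c1 ≠ c4 := by rintro rfl; exact ht _ _ _ h.e12 h.e23 h.e34.symm
  have h25 : c2 ≠ c5 := by rintro rfl; exact ht _ _ _ h.e23 h.e34 h.e45.symm
  have := h.e12.ne
  have := h.e23.ne
  have := h.e34.ne
  have := h.e45.ne
  have := h.e15.ne
  grind

/-- The constraint from the path left on deleting `c5`, for an edge `ww'` off the cycle. -/
theorem adj_of_path (h : IsFiveCycle G c1 c2 c3 c4 c5) (ht : TriangleFree G)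
    (hb : NoBipartiteThreeMatching G) (hw : w ∉ [c1, c2, c3, c4, c5])
    (hw' : w' ∉ [c1, c2, c3, c4, c5]) (hadj : G.Adj w w') :
    G.Adj w c1 ∨ G.Adj w c3 ∨ G.Adj w' c2 ∨ G.Adj w' c4 := by
  have hd := h.nodup ht
  have hne := hadj.ne
  have n13 := h.not_adj_of_dist_two ht
  have n24 := h.rotate.not_adj_of_dist_two ht
  have := hb c1 c2 c3 c4 w w' (by grind) h.e12 h.e34 hadj
  grind [G.adj_comm]

theorem not_adj_of_notMem (h : IsFiveCycle G c1 c2 c3 c4 c5) (ht : TriangleFree G)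
    (hb : NoBipartiteThreeMatching G) (hw : w ∉ [c1, c2, c3, c4, c5])
    (hw' : w' ∉ [c1, c2, c3, c4, c5]) : ¬ G.Adj w w' := by
  intro hadj
  have p1 := h.adj_of_path ht hb hw hw' hadj
  have q1 := h.adj_of_path ht hb hw' hw hadj.symm
  have p2 := h.rotate.adj_of_path ht hb (by grind) (by grind) hadj
  have q2 := h.rotate.adj_of_path ht hb (by grind) (by grind) hadj.symm
  have p3 := h.rotate.rotate.adj_of_path ht hb (by grind) (by grind) hadj
  have q3 := h.rotate.rotate.adj_of_path ht hb (by grind) (by grind) hadj.symm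
  have p4 := h.rotate.rotate.rotate.adj_of_path ht hb (by grind) (by grind) hadj
  have q4 := h.rotate.rotate.rotate.adj_of_path ht hb (by grind) (by grind) hadj.symm
  have p5 := h.rotate.rotate.rotate.rotate.adj_of_path ht hb (by grind) (by grind) hadj
  have q5 := h.rotate.rotate.rotate.rotate.adj_of_path ht hb (by grind) (by grind) hadj.symm
  have t : ∀ c, G.Adj w c → ¬ G.Adj w' c := fun c h1 h2 => ht _ _ _ hadj h2 h1
  have t1 := t c1
  have t2 := t c2
  have t3 := t c3
  have t4 := t c4
  have t5 := t c5
  have r : ∀ v c c', G.Adj c c' → G.Adj v c → ¬ G.Adj v c' := fun v c c' h1 h2 h3 =>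
    ht _ _ _ h2 h1 h3
  have r1 := r w _ _ h.e12
  have r2 := r w _ _ h.e23
  have r3 := r w _ _ h.e34
  have r4 := r w _ _ h.e45
  have r5 := r w _ _ h.e15
  have s1 := r w' _ _ h.e12
  have s2 := r w' _ _ h.e23
  have s3 := r w' _ _ h.e34
  have s4 := r w' _ _ h.e45
  have s5 := r w' _ _ h.e15
  clear t r
  grind

theorem adj_of_adj_of_adj_succ (h : IsFiveCycle G c1 c2 c3 c4 c5) (ht : TriangleFree G)
    (hb : NoBipartiteThreeMatching G) (hw : w ∉ [c1, c2, c3, c4, c5])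
    (hw' : w' ∉ [c1, c2, c3, c4, c5]) (h1 : G.Adj w c1) (h2 : G.Adj w' c2) :
    G.Adj w c4 ∧ G.Adj w' c4 := by
  have hd := h.nodup ht
  have hne : w ≠ w' := by rintro rfl; exact ht _ _ _ h1 h.e12 h2
  have n1 := h.not_adj_of_dist_two ht
  have n2 := h.rotate.not_adj_of_dist_two ht
  have n3 := h.rotate.rotate.not_adj_of_dist_two ht
  have n4 := h.rotate.rotate.rotate.not_adj_of_dist_two ht
  have n5 := h.rotate.rotate.rotate.rotate.not_adj_of_dist_two ht
  have r1 := ht w c1 c2 h1 h.e12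
  have r2 := ht w c1 c5 h1 h.e15
  have r3 := ht w' c2 c1 h2 h.e12.symm
  have r4 := ht w' c2 c3 h2 h.e23
  have hww := h.not_adj_of_notMem ht hb hw hw'
  have k1 := hb w c1 c2 w' c4 c3 (by grind) h1 h2.symm h.e34.symm
  have k2 := hb w c1 c2 w' c5 c4 (by grind) h1 h2.symm h.e45.symm
  grind [G.adj_comm]

theorem adj_or_adj_of_dist_two (h : IsFiveCycle G c1 c2 c3 c4 c5) (ht : TriangleFree G)
    (hb : NoBipartiteThreeMatching G) (hw : w ∉ [c1, c2, c3, c4, c5])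
    (hw' : w' ∉ [c1, c2, c3, c4, c5]) (h1 : G.Adj w c1) (h3 : G.Adj w' c3) :
    G.Adj w c3 ∨ G.Adj w' c1 := by
  by_cases hne : w = w'
  · subst hne
    exact Or.inl h3
  have hd := h.nodup ht
  have n1 := h.not_adj_of_dist_two ht
  have n3 := h.rotate.rotate.not_adj_of_dist_two ht
  have n4 := h.rotate.rotate.rotate.not_adj_of_dist_two ht
  have r1 := ht w c1 c5 h1 h.e15
  have r2 := ht w' c3 c4 h3 h.e34
  have hww := h.not_adj_of_notMem ht hb hw hw'
  have k1 := hb w c1 c3 w' c5 c4 (by grind) h1 h3.symm h.e45.symm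
  grind [G.adj_comm]

/-- The outside vertex `w` attaches to the cycle as in family `D3` with centre `c1`. -/
def Attaches (G : SimpleGraph V) (c1 c2 c3 c4 c5 w : V) : Prop :=
  ¬ G.Adj w c2 ∧ ¬ G.Adj w c5 ∧ (G.Adj w c3 → G.Adj w c1) ∧ (G.Adj w c4 → G.Adj w c1)

theorem attaches_of_singleton (h : IsFiveCycle G c1 c2 c3 c4 c5) (ht : TriangleFree G)
    (hb : NoBipartiteThreeMatching G) (hw : w ∉ [c1, c2, c3, c4, c5]) (h1 : G.Adj w c1)
    (h3 : ¬ G.Adj w c3) (h4 : ¬ G.Adj w c4) (hw' : w' ∉ [c1, c2, c3, c4, c5]) :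
    Attaches G c1 c2 c3 c4 c5 w' := by
  refine ⟨fun k => ?_, fun k => ?_, fun k => ?_, fun k => ?_⟩
  · exact h4 (h.adj_of_adj_of_adj_succ ht hb hw hw' h1 k).1
  · exact h3 (h.rotate.rotate.rotate.rotate.adj_of_adj_of_adj_succ ht hb (by grind) (by grind)
      k h1).2
  · exact (h.adj_or_adj_of_dist_two ht hb hw hw' h1 k).resolve_left h3
  · exact (h.rotate.rotate.rotate.adj_or_adj_of_dist_two ht hb (by grind) (by grind)
      k h1).resolve_right h4

/-- If `w` sees `c1` and `c3` and nothing outside sees `c3` alone, then `c1` or `c3` is a centre. -/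
theorem exists_attaches_of_pair (h : IsFiveCycle G c1 c2 c3 c4 c5) (ht : TriangleFree G)
    (hb : NoBipartiteThreeMatching G) (hw : w ∉ [c1, c2, c3, c4, c5]) (h1 : G.Adj w c1)
    (h3 : G.Adj w c3)
    (hpair : ∀ x ∉ [c1, c2, c3, c4, c5], G.Adj x c3 → G.Adj x c1 ∨ G.Adj x c5) :
    (∀ x ∉ [c1, c2, c3, c4, c5], Attaches G c1 c2 c3 c4 c5 x) ∨
      ∀ x ∉ [c1, c2, c3, c4, c5], Attaches G c3 c4 c5 c1 c2 x := by
  have n4 : ¬ G.Adj w c4 := ht _ _ _ h3 h.e34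
  have n2 : ∀ x ∉ [c1, c2, c3, c4, c5], ¬ G.Adj x c2 := fun x hx k =>
    n4 (h.adj_of_adj_of_adj_succ ht hb hw hx h1 k).1
  have s4 : ∀ x ∉ [c1, c2, c3, c4, c5], G.Adj x c4 → G.Adj x c1 := fun x hx k =>
    (h.rotate.rotate.adj_of_adj_of_adj_succ ht hb (by grind) (by grind) h3 k).2
  have s5 : ∀ x ∉ [c1, c2, c3, c4, c5], G.Adj x c5 → G.Adj x c3 := fun x hx k =>
    (h.rotate.rotate.rotate.rotate.adj_of_adj_of_adj_succ ht hb (by grind) (by grind) k h1).1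
  by_cases hall : ∀ x ∉ [c1, c2, c3, c4, c5], Attaches G c1 c2 c3 c4 c5 x
  · exact Or.inl hall
  push Not at hall
  obtain ⟨y, hy, hbad⟩ := hall
  have y5 : G.Adj y c5 := by
    by_contra k
    refine hbad ⟨n2 y hy, k, fun k3 => (hpair y hy k3).resolve_right k, s4 y hy⟩
  have y2 := n2 y hy
  refine Or.inr fun x hx => ⟨fun k => ?_, n2 x hx, s5 x hx, fun k => ?_⟩
  · exact y2 (h.rotate.rotate.rotate.adj_of_adj_of_adj_succ ht hb (by grind) (by grind) k y5).2
  · exact (h.rotate.rotate.rotate.rotate.adj_of_adj_of_adj_succ ht hb (w := y) (by grind)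
      (by grind) y5 k).2

/-- Some rotation of the cycle has all outside vertices attached as in family `D3`. -/
theorem exists_attaches (h : IsFiveCycle G c1 c2 c3 c4 c5) (ht : TriangleFree G)
    (hb : NoBipartiteThreeMatching G) :
    ∃ d1 d2 d3 d4 d5, IsFiveCycle G d1 d2 d3 d4 d5 ∧
      ∀ x ∉ [d1, d2, d3, d4, d5], Attaches G d1 d2 d3 d4 d5 x := by
  by_contra! hno
  have single : ∀ d1 d2 d3 d4 d5, IsFiveCycle G d1 d2 d3 d4 d5 →
      ∀ x ∉ [d1, d2, d3, d4, d5], G.Adj x d1 → G.Adj x d3 ∨ G.Adj x d4 := by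
    intro d1 d2 d3 d4 d5 hd x hx k
    by_contra! hk
    obtain ⟨y, hy, hbad⟩ := hno _ _ _ _ _ hd
    exact hbad (hd.attaches_of_singleton ht hb hx k hk.1 hk.2 hy)
  have pair : ∀ d1 d2 d3 d4 d5, IsFiveCycle G d1 d2 d3 d4 d5 →
      ∀ x ∉ [d1, d2, d3, d4, d5], G.Adj x d1 → ¬ G.Adj x d3 := by
    intro d1 d2 d3 d4 d5 hd x hx k1 k3
    rcases hd.exists_attaches_of_pair ht hb hx k1 k3 (fun y hy k => by
      have := single _ _ _ _ _ hd.rotate.rotate y (by grind) k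
      tauto) with hall | hall
    · obtain ⟨y, hy, hbad⟩ := hno _ _ _ _ _ hd
      exact hbad (hall y hy)
    · obtain ⟨y, hy, hbad⟩ := hno _ _ _ _ _ hd.rotate.rotate
      exact hbad (hall y (by grind))
  have none : ∀ d1 d2 d3 d4 d5, IsFiveCycle G d1 d2 d3 d4 d5 →
      ∀ x ∉ [d1, d2, d3, d4, d5], ¬ G.Adj x d1 := by
    intro d1 d2 d3 d4 d5 hd x hx k
    rcases single _ _ _ _ _ hd x hx k with k' | k'
    · exact pair _ _ _ _ _ hd x hx k k'
    · exact pair _ _ _ _ _ hd.rotate.rotate.rotate x (by grind) k' k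
  obtain ⟨x, hx, hbad⟩ := hno _ _ _ _ _ h
  refine hbad ⟨none _ _ _ _ _ h.rotate x (by grind),
    none _ _ _ _ _ h.rotate.rotate.rotate.rotate x (by grind),
    fun k => (none _ _ _ _ _ h.rotate.rotate x (by grind) k).elim,
    fun k => (none _ _ _ _ _ h.rotate.rotate.rotate x (by grind) k).elim⟩

theorem neighborSet_of_attaches (h : IsFiveCycle G c1 c2 c3 c4 c5) (ht : TriangleFree G)
    (hb : NoBipartiteThreeMatching G) (hw : w ∉ [c1, c2, c3, c4, c5])
    (hatt : Attaches G c1 c2 c3 c4 c5 w) :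
    G.neighborSet w = ∅ ∨ G.neighborSet w = {c1} ∨
      G.neighborSet w = {c1, c3} ∨ G.neighborSet w = {c1, c4} := by
  obtain ⟨n2, n5, k3, k4⟩ := hatt
  have hout : ∀ x, G.Adj w x → x = c1 ∨ x = c3 ∨ x = c4 := by
    intro x hx
    by_contra! hne
    refine h.not_adj_of_notMem ht hb hw (w' := x) ?_ hx
    grind
  have h34 : G.Adj w c3 → ¬ G.Adj w c4 := fun k => ht _ _ _ k h.e34
  simp only [Set.ext_iff, mem_neighborSet, Set.mem_insert_iff, Set.mem_singleton_iff,
    Set.mem_empty_iff_false]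
  grind

/-- A five-cycle with the attachments of family `D3` satisfies the inequality on every `s`. -/
theorem card_le_chi_add_theta (h : IsFiveCycle G c1 c2 c3 c4 c5)
    (hind : ∀ x y, x ∉ [c1, c2, c3, c4, c5] → y ∉ [c1, c2, c3, c4, c5] → ¬ G.Adj x y)
    (n13 : ¬ G.Adj c1 c3) (n14 : ¬ G.Adj c1 c4) (n24 : ¬ G.Adj c2 c4)
    (n25 : ¬ G.Adj c2 c5) (n35 : ¬ G.Adj c3 c5)
    (hatt : ∀ x ∉ [c1, c2, c3, c4, c5], Attaches G c1 c2 c3 c4 c5 x) (s : Finset V) :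
    s.card ≤ chi (G.induce (s : Set V)) + theta (G.induce (s : Set V)) := by
  classical
  have hcov : ∀ a b, G.Adj a b → a = c1 ∨ a = c3 ∨ a = c4 ∨ b = c1 ∨ b = c3 ∨ b = c4 := by
    intro a b hab
    by_contra! hne
    have hout : ∀ x y, G.Adj x y → y ∉ [c1, c2, c3, c4, c5] → x ∈ [c1, c2, c3, c4, c5] →
        x = c1 ∨ x = c3 ∨ x = c4 := by
      intro x y hxy hy hx
      have ha := hatt y hy
      have := hxy.symm
      unfold Attaches at ha
      grind
    have ho := hout a b hab
    have ho' := hout b a hab.symm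
    have hi := hind a b
    have := hab.symm
    have := hab.ne
    clear hout hind hatt
    grind
  have hc1 : ∀ x, G.Adj x c3 → x ≠ c4 → G.Adj x c1 := by
    intro x hx hne
    have ha := hatt x
    unfold Attaches at ha
    have := hx.ne
    have := h.e12.symm
    grind [G.adj_comm]
  have hc1' : ∀ x, G.Adj x c4 → x ≠ c3 → G.Adj x c1 := by
    intro x hx hne
    have ha := hatt x
    unfold Attaches at ha
    have := hx.ne
    have := h.e15.symm
    grind [G.adj_comm]
  by_cases s1 : c1 ∈ s
  swap
  · refine card_le_chi_add_theta_of_pair_cover G s c3 c4 fun a ha b hb hab => ?_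
    have := hcov a b hab
    grind
  by_cases s3 : ∃ x ∈ s, G.Adj x c3 ∧ x ≠ c4 ∧ c3 ∈ s
  swap
  · refine card_le_chi_add_theta_of_pair_cover G s c1 c4 fun a ha b hb hab => ?_
    have := hcov a b hab
    have := hab.symm
    grind
  by_cases s4 : ∃ x ∈ s, G.Adj x c4 ∧ x ≠ c3 ∧ c4 ∈ s
  swap
  · refine card_le_chi_add_theta_of_pair_cover G s c1 c3 fun a ha b hb hab => ?_
    have := hcov a b hab
    have := hab.symm
    grind
  obtain ⟨x, hx, hx3, hx4, h3⟩ := s3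
  obtain ⟨y, hy, hy4, hy3, h4⟩ := s4
  have hcyc : IsFiveCycle G c1 x c3 c4 y :=
    ⟨(hc1 x hx3 hx4).symm, hx3, h.e34, hy4.symm, (hc1' y hy4 hy3).symm⟩
  have hchi := hcyc.three_le_chi s s1 hx h3 h4 hy
  have htheta := card_le_theta_add_card_cover G s {c1, c3, c4} fun a _ b _ hab => by
    have := hcov a b hab
    simp only [Finset.mem_insert, Finset.mem_singleton]
    tauto
  have hcard : ({c1, c3, c4} : Finset V).card ≤ 3 := Finset.card_le_three
  omega

end IsFiveCycle

end FiveCycle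

/-- A triangle-free graph on at least two vertices is `1`-HNG iff it is a
subgraph of `K_{2,n-2}`, a subgraph of a double star, or a graph in family
`D3` (an induced `5`-cycle plus a stable set of vertices with neighborhoods
`∅`, `{c1}`, `{c1,c3}`, or `{c1,c4}`), possibly with isolated vertices. -/
theorem stmt_17 {V : Type*} [Fintype V] (G : SimpleGraph V)
    (htf : G.CliqueFree 3) (hcard : 2 ≤ Fintype.card V) :
    IsHNG G 1 ↔
      ((∃ u v : V, u ≠ v ∧ ¬ G.Adj u v ∧
          ∀ a b : V, G.Adj a b → Xor' (a = u ∨ a = v) (b = u ∨ b = v)) ∨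
        (∃ u v : V, u ≠ v ∧
          (∀ a b : V, G.Adj a b → a = u ∨ a = v ∨ b = u ∨ b = v) ∧
          (∀ w : V, w ≠ u → w ≠ v → ¬ (G.Adj w u ∧ G.Adj w v))) ∨
        (∃ c1 c2 c3 c4 c5 : V, ([c1, c2, c3, c4, c5] : List V).Nodup ∧
          G.Adj c1 c2 ∧ G.Adj c2 c3 ∧ G.Adj c3 c4 ∧ G.Adj c4 c5 ∧ G.Adj c1 c5 ∧
          ¬ G.Adj c1 c3 ∧ ¬ G.Adj c1 c4 ∧ ¬ G.Adj c2 c4 ∧ ¬ G.Adj c2 c5 ∧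
          ¬ G.Adj c3 c5 ∧
          (∀ w w' : V, w ∉ ({c1, c2, c3, c4, c5} : Set V) →
            w' ∉ ({c1, c2, c3, c4, c5} : Set V) → ¬ G.Adj w w') ∧
          (∀ w : V, w ∉ ({c1, c2, c3, c4, c5} : Set V) →
            G.neighborSet w = ∅ ∨ G.neighborSet w = {c1} ∨
            G.neighborSet w = {c1, c3} ∨ G.neighborSet w = {c1, c4}))) := by
  have ht := triangleFree_of_cliqueFree htf
  constructor
  · intro hng
    have hb := hng.noBipartiteThreeMatching
    by_cases hcov : ∃ u v : V, u ≠ v ∧ ∀ a b, G.Adj a b → a = u ∨ a = v ∨ b = u ∨ b = v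
    · obtain ⟨u, v, huv, hc⟩ := hcov
      by_cases hadj : G.Adj u v
      · exact Or.inr (Or.inl ⟨u, v, huv, hc, fun w _ _ hw => ht w u v hw.1 hadj hw.2⟩)
      · refine Or.inl ⟨u, v, huv, hadj, fun a b hab => ?_⟩
        have := hc a b hab
        have := hab.symm
        have := hab.ne
        change Xor _ _
        grind
    · push Not at hcov
      have : Nontrivial V := Fintype.one_lt_card_iff_nontrivial.1 hcard
      obtain ⟨c1, c2, c3, c4, c5, h⟩ := exists_isFiveCycle ht hb fun u v => by
        by_cases huv : u = v
        · subst huv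
          obtain ⟨v, hv⟩ := exists_ne u
          obtain ⟨a, b, hab, h⟩ := hcov u v hv.symm
          exact ⟨a, b, hab, h.1, h.1, h.2.2.1, h.2.2.1⟩
        · exact hcov u v huv
      obtain ⟨d1, d2, d3, d4, d5, hd, hatt⟩ := h.exists_attaches ht hb
      have hmem : ∀ w, w ∉ ({d1, d2, d3, d4, d5} : Set V) → w ∉ [d1, d2, d3, d4, d5] := by
        intro w hw
        simpa using hw
      refine Or.inr (Or.inr ⟨d1, d2, d3, d4, d5, hd.nodup ht, hd.e12, hd.e23, hd.e34, hd.e45,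
        hd.e15, hd.not_adj_of_dist_two ht,
        fun k => hd.rotate.rotate.rotate.not_adj_of_dist_two ht k.symm,
        hd.rotate.not_adj_of_dist_two ht,
        fun k => hd.rotate.rotate.rotate.rotate.not_adj_of_dist_two ht k.symm,
        hd.rotate.rotate.not_adj_of_dist_two ht, fun w w' hw hw' => ?_, fun w hw => ?_⟩)
      · exact hd.not_adj_of_notMem ht hb (hmem w hw) (hmem w' hw')
      · exact hd.neighborSet_of_attaches ht hb (hmem w hw) (hatt w (hmem w hw))
  · rintro (⟨u, v, -, -, hc⟩ | ⟨u, v, -, hc, -⟩ |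
      ⟨c1, c2, c3, c4, c5, hd, e12, e23, e34, e45, e15, n13, n14, n24, n25, n35, hind, hnb⟩) s
    · refine card_le_chi_add_theta_of_pair_cover G s u v fun a _ b _ hab => ?_
      rcases hc a b hab with h | h <;> tauto
    · exact card_le_chi_add_theta_of_pair_cover G s u v fun a _ b _ hab => hc a b hab
    · have hmem : ∀ w, w ∉ [c1, c2, c3, c4, c5] → w ∉ ({c1, c2, c3, c4, c5} : Set V) := by
        intro w hw
        simpa using hw
      refine IsFiveCycle.card_le_chi_add_theta ⟨e12, e23, e34, e45, e15⟩
        (fun x y hx hy => hind x y (hmem x hx) (hmem y hy)) n13 n14 n24 n25 n35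
        (fun x hx => ?_) s
      have hx' := hnb x (hmem x hx)
      simp only [Set.ext_iff, mem_neighborSet, Set.mem_insert_iff, Set.mem_singleton_iff,
        Set.mem_empty_iff_false] at hx'
      unfold IsFiveCycle.Attaches
      grind
end

section
/- If a finite simple graph G is 1-HNG and is not perfect, then there exists a vertex v of G such that G − v is perfect and ω(G − v) = ω(G). -/
open SimpleGraph

/-- `G` contains an induced copy of `H` if some induced subgraph of `G` is
isomorphic to `H`. -/
def HasInducedCopy {V W : Type*} (G : SimpleGraph V) (H : SimpleGraph W) : Prop :=
  ∃ s : Finset V, Nonempty ((G.induce (s : Set V)) ≃g H)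

/-- `G` is perfect: every induced subgraph `H` satisfies `χ(H) = ω(H)`. -/
def IsPerfect {V : Type*} [Fintype V] (G : SimpleGraph V) : Prop :=
  ∀ s : Finset V, chi (G.induce (s : Set V)) = (G.induce (s : Set V)).cliqueNum


/-! ### Colourings and cliques of finite vertex sets -/

section Basic

variable {V : Type*}

/-- The subgraph of `G` induced on `s` is `k`-colourable. -/
def ColorableOn (G : SimpleGraph V) (s : Finset V) (k : ℕ) : Prop :=
  ∃ f : V → ℕ, (∀ x ∈ s, f x < k) ∧ ∀ x ∈ s, ∀ y ∈ s, G.Adj x y → f x ≠ f y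

open Classical in
/-- The clique number of the subgraph of `G` induced on `s`. -/
noncomputable def cliqueNumOn (G : SimpleGraph V) (s : Finset V) : ℕ :=
  (s.powerset.filter fun t : Finset V => G.IsClique (t : Set V)).sup Finset.card

/-- Every induced subgraph of the subgraph of `G` induced on `s` satisfies `χ = ω`. -/
def PerfectOn (G : SimpleGraph V) (s : Finset V) : Prop :=
  ∀ t ⊆ s, ColorableOn G t (cliqueNumOn G t)

/-- The condition on stable partitions and clique partitions equivalent to being `1`-HNG. -/
def CoverBound (G : SimpleGraph V) : Prop :=
  ∀ (s : Finset V) (a b : ℕ), ColorableOn G s a → ColorableOn Gᶜ s b → s.card ≤ a + b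

theorem ColorableOn.mono {G : SimpleGraph V} {s : Finset V} {k l : ℕ} (h : ColorableOn G s k)
    (hkl : k ≤ l) : ColorableOn G s l := by
  obtain ⟨f, h1, h2⟩ := h
  exact ⟨f, fun x hx => (h1 x hx).trans_le hkl, h2⟩

theorem card_le_cliqueNumOn {G : SimpleGraph V} {s t : Finset V} (hts : t ⊆ s)
    (ht : G.IsClique (t : Set V)) : t.card ≤ cliqueNumOn G s := by
  classical
  exact Finset.le_sup (f := Finset.card) (by simp [hts, ht])

theorem exists_clique_card_eq (G : SimpleGraph V) (s : Finset V) :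
    ∃ t ⊆ s, G.IsClique (t : Set V) ∧ t.card = cliqueNumOn G s := by
  classical
  obtain ⟨t, ht, h⟩ := Finset.exists_mem_eq_sup
    (s.powerset.filter fun t : Finset V => G.IsClique (t : Set V)) ⟨∅, by simp⟩ Finset.card
  simp only [Finset.mem_filter, Finset.mem_powerset] at ht
  exact ⟨t, ht.1, ht.2, by rw [cliqueNumOn, ← h]⟩

theorem cliqueNumOn_mono (G : SimpleGraph V) {s t : Finset V} (h : s ⊆ t) :
    cliqueNumOn G s ≤ cliqueNumOn G t := by
  obtain ⟨u, hu, hc, hn⟩ := exists_clique_card_eq G s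
  exact hn ▸ card_le_cliqueNumOn (hu.trans h) hc

theorem ColorableOn.cliqueNumOn_le {G : SimpleGraph V} {s : Finset V} {k : ℕ}
    (h : ColorableOn G s k) : cliqueNumOn G s ≤ k := by
  obtain ⟨u, hu, hc, hn⟩ := exists_clique_card_eq G s
  obtain ⟨f, h1, h2⟩ := h
  rw [← hn, ← Finset.card_range k]
  refine Finset.card_le_card_of_injOn f (fun x hx => by simpa using h1 x (hu hx)) ?_
  intro x hx y hy hxy
  by_contra hne
  exact h2 x (hu hx) y (hu hy) (hc hx hy hne) hxy

theorem PerfectOn.mono {G : SimpleGraph V} {s t : Finset V} (h : PerfectOn G t) (hst : s ⊆ t) :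
    PerfectOn G s := fun u hu => h u (hu.trans hst)

theorem not_adj_of_isClique_compl {G : SimpleGraph V} {A : Finset V}
    (hA : Gᶜ.IsClique (A : Set V)) :
    ∀ x ∈ A, ∀ y ∈ A, ¬ G.Adj x y := by
  intro x hx y hy hxy
  exact (hA hx hy hxy.ne).2 hxy

theorem chi_le_iff_colorableOn {W : Type*} [Finite W] {G : SimpleGraph V} {H : SimpleGraph W}
    (φ : H ↪g G) {s : Finset V} (hs : ∀ x, x ∈ s ↔ ∃ w, φ w = x) (k : ℕ) :
    chi H ≤ k ↔ ColorableOn G s k := by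
  classical
  have hfin : H.chromaticNumber ≠ ⊤ := by
    have := Fintype.ofFinite W
    exact chromaticNumber_ne_top_iff_exists.2 ⟨_, colorable_of_fintype H⟩
  have h1 : chi H ≤ k ↔ H.Colorable k := by
    rw [← chromaticNumber_le_iff_colorable, chi, ← ENat.natCast_le_natCast, ENat.natCast_toNat hfin]
  rw [h1, colorable_iff_exists_bdd_nat_coloring]
  constructor
  · rintro ⟨C, hC⟩
    refine ⟨fun x => if h : ∃ w, φ w = x then C h.choose else 0, ?_, ?_⟩
    · intro x hx
      have h := (hs x).1 hx
      simp only [h, dite_true]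
      exact hC _
    · intro x hx y hy hxy
      have h := (hs x).1 hx
      have h' := (hs y).1 hy
      simp only [h, h', dite_true]
      apply C.valid
      rw [← φ.map_adj_iff, h.choose_spec, h'.choose_spec]
      exact hxy
  · rintro ⟨f, hf, hf'⟩
    refine ⟨Coloring.mk (fun w => f (φ w)) ?_, fun w => hf _ ((hs _).2 ⟨w, rfl⟩)⟩
    intro v w hvw
    exact hf' _ ((hs _).2 ⟨v, rfl⟩) _ ((hs _).2 ⟨w, rfl⟩) (φ.map_adj_iff.2 hvw)

theorem cliqueNum_eq_cliqueNumOn {W : Type*} [Finite W] {G : SimpleGraph V} {H : SimpleGraph W}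
    (φ : H ↪g G) {s : Finset V} (hs : ∀ x, x ∈ s ↔ ∃ w, φ w = x) :
    H.cliqueNum = cliqueNumOn G s := by
  classical
  apply le_antisymm
  · obtain ⟨t, ht⟩ := H.exists_isNClique_cliqueNum
    rw [← ht.card_eq, ← Finset.card_map φ.toEmbedding]
    apply card_le_cliqueNumOn
    · intro x hx
      obtain ⟨w, -, rfl⟩ := Finset.mem_map.1 hx
      exact (hs _).2 ⟨w, rfl⟩
    · intro x hx y hy hxy
      obtain ⟨v, hv, rfl⟩ := Finset.mem_map.1 hx
      obtain ⟨w, hw, rfl⟩ := Finset.mem_map.1 hy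
      exact φ.map_adj_iff.2 (ht.isClique hv hw fun h => hxy (by rw [h]))
  · obtain ⟨t, hts, ht, hn⟩ := exists_clique_card_eq G s
    rw [← hn]
    have h2 : (t.preimage φ φ.injective.injOn).map φ.toEmbedding = t := by
      ext x
      simp only [Finset.mem_map, Finset.mem_preimage]
      constructor
      · rintro ⟨w, hw, rfl⟩
        exact hw
      · intro hx
        obtain ⟨w, rfl⟩ := (hs x).1 (hts hx)
        exact ⟨w, hx, rfl⟩
    rw [← h2, Finset.card_map]
    apply IsClique.card_le_cliqueNum
    intro v hv w hw hvw
    rw [← φ.map_adj_iff]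
    exact ht (by simpa using hv) (by simpa using hw) (φ.injective.ne hvw)

theorem mem_iff_induce_embedding (G : SimpleGraph V) (s : Finset V) (x : V) :
    x ∈ s ↔ ∃ w, Embedding.induce (G := G) (s : Set V) w = x := by
  constructor
  · intro h
    exact ⟨⟨x, h⟩, rfl⟩
  · rintro ⟨w, rfl⟩
    exact w.2

theorem IsHNG.coverBound [Fintype V] {G : SimpleGraph V} (hG : IsHNG G 1) : CoverBound G := by
  intro s a b ha hb
  have h := hG s
  have h1 := (chi_le_iff_colorableOn _ (mem_iff_induce_embedding G s) a).2 ha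
  have h2 := (chi_le_iff_colorableOn _ (mem_iff_induce_embedding Gᶜ s) b).2 hb
  have h3 : (G.induce (s : Set V))ᶜ = Gᶜ.induce (s : Set V) := by
    ext x y
    simp only [compl_adj, comap_adj, Function.Embedding.subtype_apply, ne_eq, Subtype.coe_inj]
  rw [theta, h3] at h
  omega

theorem CoverBound.compl {G : SimpleGraph V} (hG : CoverBound G) : CoverBound Gᶜ := by
  intro s a b ha hb
  rw [compl_compl] at hb
  have := hG s b a hb ha
  omega

theorem exists_not_colorableOn [Fintype V] {G : SimpleGraph V} (h : ¬ IsPerfect G) :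
    ∃ s, ¬ ColorableOn G s (cliqueNumOn G s) := by
  by_contra! hc
  refine h fun s => ?_
  have h1 := mem_iff_induce_embedding G s
  rw [cliqueNum_eq_cliqueNumOn _ h1]
  apply le_antisymm
  · exact (chi_le_iff_colorableOn _ h1 _).2 (hc s)
  · exact ((chi_le_iff_colorableOn _ h1 _).1 le_rfl).cliqueNumOn_le

theorem isPerfect_induce_compl_singleton [Fintype V] [DecidableEq V] {G : SimpleGraph V} {v : V}
    (h : PerfectOn G (Finset.univ.erase v)) : IsPerfect (G.induce ({v}ᶜ : Set V)) := by
  intro s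
  have h1 : ∀ x, x ∈ s.map (Function.Embedding.subtype _) ↔
      ∃ w, ((Embedding.induce (G := G) ({v}ᶜ : Set V)).comp
        (Embedding.induce (s : Set ({v}ᶜ : Set V)))) w = x := by
    intro x
    simp only [Finset.mem_map]
    constructor
    · rintro ⟨w, hw, rfl⟩
      exact ⟨⟨w, hw⟩, rfl⟩
    · rintro ⟨w, rfl⟩
      exact ⟨w.1, w.2, rfl⟩
  rw [cliqueNum_eq_cliqueNumOn _ h1]
  apply le_antisymm
  · refine (chi_le_iff_colorableOn _ h1 _).2 (h _ ?_)
    intro x hx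
    obtain ⟨w, -, rfl⟩ := Finset.mem_map.1 hx
    exact Finset.mem_erase.2 ⟨w.2, Finset.mem_univ _⟩
  · exact ((chi_le_iff_colorableOn _ h1 _).1 le_rfl).cliqueNumOn_le

theorem cliqueNum_induce_compl_singleton [Fintype V] [DecidableEq V] (G : SimpleGraph V) (v : V) :
    (G.induce ({v}ᶜ : Set V)).cliqueNum = cliqueNumOn G (Finset.univ.erase v) := by
  apply cliqueNum_eq_cliqueNumOn (Embedding.induce (G := G) ({v}ᶜ : Set V))
  intro x
  constructor
  · intro hx
    exact ⟨⟨x, by simpa using hx⟩, rfl⟩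
  · rintro ⟨w, rfl⟩
    exact Finset.mem_erase.2 ⟨w.2, Finset.mem_univ _⟩

theorem cliqueNum_eq_cliqueNumOn_univ [Fintype V] (G : SimpleGraph V) :
    G.cliqueNum = cliqueNumOn G Finset.univ :=
  cliqueNum_eq_cliqueNumOn Embedding.refl fun x => by simp

end Basic

/-! ### The Lovász inequality for minimally imperfect graphs -/

section Lovasz

variable {V : Type*} [DecidableEq V] {G : SimpleGraph V} {s : Finset V}

theorem card_inter_le_one_of_clique_of_stable {K A : Finset V} (hK : G.IsClique (K : Set V))
    (hA : ∀ x ∈ A, ∀ y ∈ A, ¬ G.Adj x y) : (K ∩ A).card ≤ 1 := by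
  rw [Finset.card_le_one]
  intro x hx y hy
  rw [Finset.mem_inter] at hx hy
  by_contra hne
  exact hA x hx.2 y hy.2 (hK hx.1 hy.1 hne)

theorem exists_maximum_clique_disjoint (hperf : ∀ t ⊂ s, ColorableOn G t (cliqueNumOn G t))
    (hnot : ¬ ColorableOn G s (cliqueNumOn G s)) {A : Finset V} (hAs : A ⊆ s)
    (hA : ∀ x ∈ A, ∀ y ∈ A, ¬ G.Adj x y) :
    ∃ K ⊆ s, G.IsClique (K : Set V) ∧ K.card = cliqueNumOn G s ∧ Disjoint K A := by
  rcases A.eq_empty_or_nonempty with rfl | ⟨a, ha⟩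
  · obtain ⟨K, h1, h2, h3⟩ := exists_clique_card_eq G s
    exact ⟨K, h1, h2, h3, by simp⟩
  have hss : s \ A ⊂ s := Finset.sdiff_ssubset hAs ⟨a, ha⟩
  obtain ⟨K, h1, h2, h3⟩ := exists_clique_card_eq G (s \ A)
  have hle := cliqueNumOn_mono G hss.1
  rcases hle.lt_or_eq with hlt | heq
  · exfalso
    apply hnot
    obtain ⟨f, hf, hf'⟩ := hperf _ hss
    refine ⟨fun x => if x ∈ A then cliqueNumOn G (s \ A) else f x, ?_, ?_⟩
    · intro x hx
      by_cases hxA : x ∈ A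
      · simpa [hxA] using hlt
      · simpa [hxA] using (hf x (by simp [hx, hxA])).trans hlt
    · intro x hx y hy hxy
      by_cases hxA : x ∈ A <;> by_cases hyA : y ∈ A
      · exact absurd hxy (hA x hxA y hyA)
      · simpa [hxA, hyA] using (hf y (by simp [hy, hyA])).ne'
      · simpa [hxA, hyA] using (hf x (by simp [hx, hxA])).ne
      · simpa [hxA, hyA] using hf' x (by simp [hx, hxA]) y (by simp [hy, hyA]) hxy
  · exact ⟨K, h1.trans hss.1, h2, h3.trans heq, (Finset.subset_sdiff.1 h1).2⟩

theorem cliqueNumOn_mul_lt_card (hperf : ∀ t ⊂ s, ColorableOn G t (cliqueNumOn G t))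
    (hnot : ¬ ColorableOn G s (cliqueNumOn G s)) :
    cliqueNumOn G s * cliqueNumOn Gᶜ s < s.card := by
  obtain ⟨A₀, hA₀s, hA₀, hα⟩ := exists_clique_card_eq Gᶜ s
  set ω := cliqueNumOn G s with hω
  rw [← hα]
  have hcol : ∀ a : A₀, ColorableOn G (s.erase a) ω := fun a =>
    (hperf _ (Finset.erase_ssubset (hA₀s a.2))).mono
      (cliqueNumOn_mono G (Finset.erase_subset _ _))
  choose f hf hf' using hcol
  let A : Option (A₀ × Fin ω) → Finset V := fun i =>
    i.elim A₀ fun p => (s.erase p.1).filter fun x => f p.1 x = p.2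
  have hAs : ∀ i, A i ⊆ s := by
    rintro (_ | ⟨a, c⟩)
    · exact hA₀s
    · exact (Finset.filter_subset _ _).trans (Finset.erase_subset _ _)
  have hA : ∀ i, ∀ x ∈ A i, ∀ y ∈ A i, ¬ G.Adj x y := by
    rintro (_ | ⟨a, c⟩)
    · exact not_adj_of_isClique_compl hA₀
    · intro x hx y hy hxy
      simp only [A, Option.elim_some, Finset.mem_filter] at hx hy
      exact hf' a x hx.1 y hy.1 hxy (hx.2.trans hy.2.symm)
  choose K hKs hK hKω hKA using fun i => exists_maximum_clique_disjoint hperf hnot (hAs i) (hA i)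
  have hcount : ∀ x ∈ s, (∑ i, if x ∈ A i then 1 else 0) = A₀.card := by
    intro x hx
    rw [Fintype.sum_option, Fintype.sum_prod_type]
    have h1 : ∀ a : A₀, (∑ c : Fin ω, if x ∈ A (some (a, c)) then 1 else 0) =
        if x = a then 0 else 1 := by
      intro a
      by_cases hxa : x = a
      · simp [A, hxa]
      · have h2 := hf a x (by simp [hxa, hx])
        rw [Finset.sum_eq_single (⟨f a x, h2⟩ : Fin ω)]
        · simp [A, hxa, hx]
        · intro c _ hc
          have : f a x ≠ c := fun h => hc (Fin.ext h.symm)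
          simp [A, this]
        · simp
    rw [Finset.sum_congr rfl fun a _ => h1 a]
    rw [Finset.sum_coe_sort A₀ fun a => if x = a then 0 else 1]
    by_cases hx0 : x ∈ A₀
    · have h3 : (∑ a ∈ A₀, if x = a then 0 else 1) = (A₀.erase x).card := by
        rw [← Finset.add_sum_erase _ _ hx0, Finset.card_eq_sum_ones]
        simp only [if_true, zero_add]
        exact Finset.sum_congr rfl fun a ha => by simp [(Finset.ne_of_mem_erase ha).symm]
      rw [h3]
      have := Finset.card_erase_add_one hx0
      simp only [A, Option.elim_none, hx0, if_true]
      omega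
    · have h3 : (∑ a ∈ A₀, if x = a then 0 else 1) = A₀.card := by
        rw [Finset.card_eq_sum_ones]
        refine Finset.sum_congr rfl fun a ha => ?_
        have : x ≠ a := fun h => hx0 (h ▸ ha)
        simp [this]
      rw [h3]
      simp [A, hx0]
  have hcard : Fintype.card (Option (A₀ × Fin ω)) = ω * A₀.card + 1 := by
    simp [mul_comm]
  have hinter : ∀ i j, (K i ∩ A j).card = if i = j then 0 else 1 := by
    intro i
    have h1 : (K i ∩ A i).card = 0 := by
      rw [Finset.card_eq_zero]
      exact Finset.disjoint_iff_inter_eq_empty.1 (hKA i)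
    have h2 : ∑ j, (K i ∩ A j).card = ω * A₀.card := by
      have : ∀ j, (K i ∩ A j).card = ∑ x ∈ K i, if x ∈ A j then 1 else 0 := by
        intro j
        rw [← Finset.filter_mem_eq_inter, Finset.card_filter]
      rw [Finset.sum_congr rfl fun j _ => this j, Finset.sum_comm,
        Finset.sum_congr rfl fun x hx => hcount x (hKs i hx), Finset.sum_const, hKω, smul_eq_mul]
    have h3 : ∑ j ∈ Finset.univ.erase i, (K i ∩ A j).card = ∑ j ∈ Finset.univ.erase i, 1 := by
      rw [← Finset.add_sum_erase _ _ (Finset.mem_univ i), h1, zero_add] at h2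
      rw [h2, Finset.sum_const, Finset.card_erase_of_mem (Finset.mem_univ i), Finset.card_univ,
        hcard]
      simp
    have h4 := (Finset.sum_eq_sum_iff_of_le fun j _ =>
      card_inter_le_one_of_clique_of_stable (hK i) (hA j)).1 h3
    intro j
    by_cases hij : i = j
    · subst hij
      simpa using h1
    · simpa [hij] using h4 j (by simp [Ne.symm hij])
  have hpos : 0 < s.card := by
    rw [Finset.card_pos, Finset.nonempty_iff_ne_empty]
    rintro rfl
    exact hnot ⟨fun _ => 0, by simp, by simp⟩
  rcases Nat.eq_zero_or_pos (ω * A₀.card) with h0 | h0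
  · rwa [h0]
  have hlin : LinearIndependent ℚ
      (fun i => (fun x : s => if (x : V) ∈ A i then (1 : ℚ) else 0)) := by
    rw [Fintype.linearIndependent_iff]
    intro g hg
    have h1 : ∀ i, ∑ j, g j = g i := by
      intro i
      have h2 : ∑ x ∈ K i, ∑ j, g j * (if x ∈ A j then (1 : ℚ) else 0) = 0 := by
        refine Finset.sum_eq_zero fun x hx => ?_
        have := congrFun hg ⟨x, hKs i hx⟩
        simpa using this
      rw [Finset.sum_comm] at h2
      have h3 : ∀ j, ∑ x ∈ K i, g j * (if x ∈ A j then (1 : ℚ) else 0) =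
          g j - if i = j then g j else 0 := by
        intro j
        have h4 := hinter i j
        rw [← Finset.filter_mem_eq_inter, Finset.card_filter] at h4
        have h5 : ∑ x ∈ K i, (if x ∈ A j then (1 : ℚ) else 0) = if i = j then 0 else 1 := by
          exact_mod_cast h4
        rw [← Finset.mul_sum, h5]
        split_ifs <;> simp
      rw [Finset.sum_congr rfl fun j _ => h3 j, Finset.sum_sub_distrib] at h2
      simp only [Finset.sum_ite_eq, Finset.mem_univ, if_true] at h2
      linarith
    have h2 : ∑ j, g j = (ω * A₀.card + 1 : ℕ) * ∑ j, g j := by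
      conv_lhs => rw [← Finset.sum_congr rfl fun i _ => h1 i]
      rw [Finset.sum_const, Finset.card_univ, hcard, nsmul_eq_mul]
    have h3 : ((ω * A₀.card : ℕ) : ℚ) * ∑ j, g j = 0 := by
      push_cast at h2 ⊢
      linarith
    intro i
    rw [← h1 i]
    rcases mul_eq_zero.1 h3 with h | h
    · rw [Nat.cast_eq_zero] at h
      omega
    · exact h
  have := hlin.fintype_card_le_finrank
  rw [hcard, Module.finrank_pi, Fintype.card_coe] at this
  omega

end Lovasz

/-! ### Minimal obstructions to perfection of a graph and its complement -/

section MinimalObstruction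

variable {V : Type*} {G : SimpleGraph V} {s t : Finset V}

theorem ColorableOn.union [DecidableEq V] {a b : ℕ} (hs : ColorableOn G s a)
    (ht : ColorableOn G t b) :
    ColorableOn G (s ∪ t) (a + b) := by
  obtain ⟨f, hf, hf'⟩ := hs
  obtain ⟨g, hg, hg'⟩ := ht
  refine ⟨fun x => if x ∈ s then f x else a + g x, ?_, ?_⟩
  · intro x hx
    by_cases hxs : x ∈ s
    · have := hf x hxs
      simp only [hxs, if_true]
      omega
    · have := hg x ((Finset.mem_union.1 hx).resolve_left hxs)
      simp only [hxs, if_false]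
      omega
  · intro x hx y hy hxy
    by_cases hxs : x ∈ s <;> by_cases hys : y ∈ s
    · simpa [hxs, hys] using hf' x hxs y hys hxy
    · have := hf x hxs
      simp only [hxs, hys, if_true, if_false]
      omega
    · have := hf y hys
      simp only [hxs, hys, if_true, if_false]
      omega
    · have := hg' x ((Finset.mem_union.1 hx).resolve_left hxs) y
        ((Finset.mem_union.1 hy).resolve_left hys) hxy
      simpa [hxs, hys] using this

theorem ColorableOn.union_of_not_adj [DecidableEq V] {k : ℕ} (hs : ColorableOn G s k)
    (ht : ColorableOn G t k) (h : ∀ x ∈ s, ∀ y ∈ t, ¬ G.Adj x y) : ColorableOn G (s ∪ t) k := by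
  obtain ⟨f, hf, hf'⟩ := hs
  obtain ⟨g, hg, hg'⟩ := ht
  refine ⟨fun x => if x ∈ s then f x else g x, ?_, ?_⟩
  · intro x hx
    by_cases hxs : x ∈ s
    · simpa [hxs] using hf x hxs
    · simpa [hxs] using hg x ((Finset.mem_union.1 hx).resolve_left hxs)
  · intro x hx y hy hxy
    by_cases hxs : x ∈ s <;> by_cases hys : y ∈ s
    · simpa [hxs, hys] using hf' x hxs y hys hxy
    · exact absurd hxy (h x hxs y ((Finset.mem_union.1 hy).resolve_left hys))
    · exact absurd hxy.symm (h y hys x ((Finset.mem_union.1 hx).resolve_left hxs))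
    · have := hg' x ((Finset.mem_union.1 hx).resolve_left hxs) y
        ((Finset.mem_union.1 hy).resolve_left hys) hxy
      simpa [hxs, hys] using this

theorem colorableOn_one (h : ∀ x ∈ s, ∀ y ∈ s, ¬ G.Adj x y) : ColorableOn G s 1 :=
  ⟨fun _ => 0, fun _ _ => one_pos, fun x hx y hy hxy => absurd hxy (h x hx y hy)⟩

theorem colorableOn_pair [DecidableEq V] {x y : V} (h : ¬ G.Adj x y) : ColorableOn G {x, y} 1 := by
  apply colorableOn_one
  intro a ha b hb hab
  simp only [Finset.mem_insert, Finset.mem_singleton] at ha hb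
  rcases ha with rfl | rfl <;> rcases hb with rfl | rfl
  · exact hab.ne rfl
  · exact h hab
  · exact h hab.symm
  · exact hab.ne rfl

theorem exists_injOn_lt_card (s : Finset V) :
    ∃ f : V → ℕ, (∀ x ∈ s, f x < s.card) ∧ Set.InjOn f s := by
  classical
  refine ⟨fun x => if h : x ∈ s then s.equivFin ⟨x, h⟩ else 0, ?_, ?_⟩
  · intro x hx
    simp [hx]
  · intro x hx y hy hxy
    rw [Finset.mem_coe] at hx hy
    simpa [hx, hy, Fin.val_inj] using hxy

theorem colorableOn_card (G : SimpleGraph V) (s : Finset V) : ColorableOn G s s.card := by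
  obtain ⟨f, hf, hinj⟩ := exists_injOn_lt_card s
  exact ⟨f, hf, fun x hx y hy hxy h => hxy.ne (hinj hx hy h)⟩

theorem ColorableOn.card_le_mul {k : ℕ} (h : ColorableOn G s k) :
    s.card ≤ k * cliqueNumOn Gᶜ s := by
  obtain ⟨f, hf, hf'⟩ := h
  rw [mul_comm]
  have h1 : ∀ b ∈ Finset.range k, (s.filter fun x => f x = b).card ≤ cliqueNumOn Gᶜ s := by
    intro b _
    apply card_le_cliqueNumOn (Finset.filter_subset _ _)
    intro x hx y hy hxy
    simp only [Finset.coe_filter, Set.mem_ofPred_eq] at hx hy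
    exact ⟨hxy, fun hadj => hf' x hx.1 y hy.1 hadj (hx.2.trans hy.2.symm)⟩
  simpa using Finset.card_le_mul_card_image_of_maps_to (s := s) (f := f) (t := Finset.range k)
    (fun x hx => by simpa using hf x hx) _ h1

/-- Every induced subgraph with a clique and a stable set covering it satisfies `χ = ω`. -/
theorem colorableOn_union_of_clique_of_stable [DecidableEq V] {X Y : Finset V}
    (hX : G.IsClique (X : Set V)) (hY : ∀ x ∈ Y, ∀ y ∈ Y, ¬ G.Adj x y) :
    ColorableOn G (X ∪ Y) (cliqueNumOn G (X ∪ Y)) := by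
  by_cases h : ∃ y ∈ Y, ∀ x ∈ X, G.Adj y x
  · obtain ⟨y, hy, hyX⟩ := h
    refine ((colorableOn_card G X).union (colorableOn_one hY)).mono ?_
    have hyX' : y ∉ X := fun hy' => (hyX y hy').ne rfl
    rw [← Finset.card_insert_of_notMem hyX']
    apply card_le_cliqueNumOn
    · intro x hx
      rcases Finset.mem_insert.1 hx with rfl | hx
      · exact Finset.mem_union_right _ hy
      · exact Finset.mem_union_left _ hx
    · rw [Finset.coe_insert]
      exact hX.insert fun x hx _ => hyX x hx
  · push Not at h
    refine ColorableOn.mono ?_ (card_le_cliqueNumOn Finset.subset_union_left hX)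
    obtain ⟨f, hf, hinj⟩ := exists_injOn_lt_card X
    choose! g hg hg' using h
    refine ⟨fun x => if x ∈ X then f x else f (g x), ?_, ?_⟩
    · intro x hx
      by_cases hxX : x ∈ X
      · simpa [hxX] using hf x hxX
      · simpa [hxX] using hf _ (hg x ((Finset.mem_union.1 hx).resolve_left hxX))
    · intro x hx y hy hxy
      by_cases hxX : x ∈ X <;> by_cases hyX : y ∈ X
      · simp only [hxX, hyX, if_true]
        exact fun h => hxy.ne (hinj hxX hyX h)
      · have hy' := (Finset.mem_union.1 hy).resolve_left hyX
        simp only [hxX, hyX, if_true, if_false]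
        intro h
        have := hinj hxX (hg y hy') h
        exact hg' y hy' (this ▸ hxy.symm)
      · have hx' := (Finset.mem_union.1 hx).resolve_left hxX
        simp only [hxX, hyX, if_true, if_false]
        intro h
        have := hinj (hg x hx') hyX h
        exact hg' x hx' (this ▸ hxy)
      · exact absurd hxy (hY x ((Finset.mem_union.1 hx).resolve_left hxX) y
          ((Finset.mem_union.1 hy).resolve_left hyX))

/-- `χ = ω` holds for the subgraph of `G` induced on `s` and for its complement. -/
def BiTight (G : SimpleGraph V) (s : Finset V) : Prop :=
  ColorableOn G s (cliqueNumOn G s) ∧ ColorableOn Gᶜ s (cliqueNumOn Gᶜ s)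

/-- `s` is minimal among the vertex sets for which `BiTight` fails. -/
def IsMinimalObstruction (G : SimpleGraph V) (s : Finset V) : Prop :=
  ¬ BiTight G s ∧ ∀ t ⊂ s, BiTight G t

theorem BiTight.compl (h : BiTight G s) : BiTight Gᶜ s := by
  refine ⟨h.2, ?_⟩
  rw [compl_compl]
  exact h.1

theorem IsMinimalObstruction.compl (h : IsMinimalObstruction G s) :
    IsMinimalObstruction Gᶜ s := by
  refine ⟨fun hb => h.1 ?_, fun t ht => (h.2 t ht).compl⟩
  have := hb.compl
  rwa [compl_compl] at this

theorem exists_isMinimalObstruction (h : ¬ BiTight G s) :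
    ∃ t ⊆ s, IsMinimalObstruction G t := by
  induction s using Finset.strongInduction with
  | H s ih =>
    by_cases hs : ∀ t ⊂ s, BiTight G t
    · exact ⟨s, subset_rfl, h, hs⟩
    · push Not at hs
      obtain ⟨t, hts, ht⟩ := hs
      obtain ⟨u, hu, hmin⟩ := ih t hts ht
      exact ⟨u, hu.trans hts.1, hmin⟩

theorem perfectOn_of_forall_not_isMinimalObstruction
    (h : ∀ t ⊆ s, ¬ IsMinimalObstruction G t) : PerfectOn G s := by
  intro t ht
  by_contra hn
  obtain ⟨u, hu, hmin⟩ := exists_isMinimalObstruction (s := t) fun hb => hn hb.1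
  exact h u (hu.trans ht) hmin

namespace IsMinimalObstruction

variable [DecidableEq V]

theorem colorableOn_erase (h : IsMinimalObstruction G s) {v : V} (hv : v ∈ s) :
    ColorableOn G (s.erase v) (cliqueNumOn G s) :=
  (h.2 _ (Finset.erase_ssubset hv)).1.mono (cliqueNumOn_mono G (Finset.erase_subset _ _))

theorem cliqueNumOn_mul_lt_card (h : IsMinimalObstruction G s) :
    cliqueNumOn G s * cliqueNumOn Gᶜ s < s.card := by
  by_cases h1 : ColorableOn G s (cliqueNumOn G s)
  · have h2 : ¬ ColorableOn Gᶜ s (cliqueNumOn Gᶜ s) := fun h2 => h.1 ⟨h1, h2⟩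
    have := _root_.cliqueNumOn_mul_lt_card (G := Gᶜ) (fun t ht => (h.2 t ht).2) h2
    rwa [compl_compl, mul_comm] at this
  · exact _root_.cliqueNumOn_mul_lt_card (fun t ht => (h.2 t ht).1) h1

theorem nonempty (h : IsMinimalObstruction G s) : s.Nonempty := by
  rw [← Finset.card_pos]
  exact (Nat.zero_le _).trans_lt h.cliqueNumOn_mul_lt_card

theorem card_eq (h : IsMinimalObstruction G s) :
    s.card = cliqueNumOn G s * cliqueNumOn Gᶜ s + 1 := by
  obtain ⟨v, hv⟩ := h.nonempty
  have h1 := (h.colorableOn_erase hv).card_le_mul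
  have h2 := cliqueNumOn_mono Gᶜ (Finset.erase_subset v s)
  have h3 := Nat.mul_le_mul_left (cliqueNumOn G s) h2
  have h4 := Finset.card_erase_add_one hv
  have h5 := h.cliqueNumOn_mul_lt_card
  omega

theorem two_le_cliqueNumOn (h : IsMinimalObstruction G s) : 2 ≤ cliqueNumOn G s := by
  by_contra hlt
  obtain ⟨v, hv⟩ := h.nonempty
  have h1 : ({v} : Finset V).card ≤ cliqueNumOn G s :=
    card_le_cliqueNumOn (by simpa using hv) (by simp)
  have h2 : cliqueNumOn G s = 1 := by
    rw [Finset.card_singleton] at h1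
    omega
  have h3 : s.card ≤ cliqueNumOn Gᶜ s := by
    apply card_le_cliqueNumOn subset_rfl
    intro x hx y hy hxy
    refine ⟨hxy, fun hadj => ?_⟩
    have h4 : ({x, y} : Finset V).card ≤ cliqueNumOn G s := by
      apply card_le_cliqueNumOn
      · intro z hz
        simp only [Finset.mem_insert, Finset.mem_singleton] at hz
        rcases hz with rfl | rfl <;> assumption
      · simpa [hxy] using hadj
    rw [Finset.card_pair hxy] at h4
    omega
  have h4 := h.card_eq
  rw [h2, one_mul] at h4
  omega

theorem colorableOn_insert (h : IsMinimalObstruction G s) {u v : V} (hv : v ∈ s)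
    (huv : ¬ G.Adj u v) :
    ColorableOn G (insert u s) (cliqueNumOn G s + 1) := by
  have := (h.colorableOn_erase hv).union (colorableOn_pair huv)
  have h0 : s.erase v ∪ {u, v} = insert u s := by
    ext x
    by_cases hx : x = v <;> simp [hx, hv, or_comm]
  rwa [h0] at this

theorem not_adj_of_anticomplete (h : IsMinimalObstruction G s) (hG : CoverBound G) {x y : V}
    (hxs : x ∉ s) (hys : y ∉ s) (hx : ∀ v ∈ s, ¬ G.Adj x v) (hy : ∀ v ∈ s, ¬ G.Adj y v) :
    ¬ G.Adj x y := by
  intro hxy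
  obtain ⟨v, hv⟩ := h.nonempty
  have h1 : ColorableOn G (s.erase v ∪ {x, y}) (cliqueNumOn G s) := by
    apply (h.colorableOn_erase hv).union_of_not_adj
    · refine (colorableOn_card G _).mono ?_
      rw [Finset.card_pair hxy.ne]
      exact h.two_le_cliqueNumOn
    · intro a ha b hb hab
      simp only [Finset.mem_insert, Finset.mem_singleton] at hb
      rcases hb with rfl | rfl
      · exact hx a (Finset.mem_of_mem_erase ha) hab.symm
      · exact hy a (Finset.mem_of_mem_erase ha) hab.symm
  have h2 : ColorableOn Gᶜ (s.erase v ∪ {x, y}) (cliqueNumOn Gᶜ s + 1) :=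
    (h.compl.colorableOn_erase hv).union (colorableOn_pair fun hc => hc.2 hxy)
  have h3 := hG _ _ _ h1 h2
  rw [Finset.card_union_of_disjoint, Finset.card_pair hxy.ne] at h3
  · have h4 := Finset.card_erase_add_one hv
    have h5 := h.card_eq
    have h6 := h.two_le_cliqueNumOn
    have h7 := h.compl.two_le_cliqueNumOn
    nlinarith
  · rw [Finset.disjoint_right]
    intro a ha ha'
    simp only [Finset.mem_insert, Finset.mem_singleton] at ha
    rcases ha with rfl | rfl
    · exact hxs (Finset.mem_of_mem_erase ha')
    · exact hys (Finset.mem_of_mem_erase ha')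

theorem complete_or_anticomplete (h : IsMinimalObstruction G s) (hG : CoverBound G)
    (hlt : cliqueNumOn G s + cliqueNumOn Gᶜ s < cliqueNumOn G s * cliqueNumOn Gᶜ s)
    {u : V} (hu : u ∉ s) : (∀ v ∈ s, G.Adj u v) ∨ ∀ v ∈ s, ¬ G.Adj u v := by
  by_contra! hc
  obtain ⟨⟨v, hv, huv⟩, w, hw, huw⟩ := hc
  have h1 := h.colorableOn_insert hv huv
  have h2 := h.compl.colorableOn_insert hw fun hc => hc.2 huw
  have h3 := hG _ _ _ h1 h2
  rw [Finset.card_insert_of_notMem hu, h.card_eq] at h3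
  omega

/-- Deleting a vertex of a minimal obstruction all of whose outside vertices are complete or
anticomplete to it leaves a perfect graph. -/
theorem perfectOn_erase (h : IsMinimalObstruction G s) [Fintype V] (hG : CoverBound G)
    (hlt : cliqueNumOn G s + cliqueNumOn Gᶜ s < cliqueNumOn G s * cliqueNumOn Gᶜ s)
    {v : V} (hv : v ∈ s) : PerfectOn G (Finset.univ.erase v) := by
  classical
  intro t ht
  set X := t.filter fun x => x ∉ s ∧ ∀ w ∈ s, G.Adj x w with hXdef
  set Y := t.filter fun x => x ∉ s ∧ ∀ w ∈ s, ¬ G.Adj x w with hYdef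
  have hX : G.IsClique (X : Set V) := by
    intro x hx y hy hxy
    simp only [hXdef, Finset.coe_filter, Set.mem_ofPred_eq] at hx hy
    by_contra hadj
    exact h.compl.not_adj_of_anticomplete hG.compl hx.2.1 hy.2.1
      (fun w hw hc => hc.2 (hx.2.2 w hw)) (fun w hw hc => hc.2 (hy.2.2 w hw)) ⟨hxy, hadj⟩
  have hY : ∀ x ∈ Y, ∀ y ∈ Y, ¬ G.Adj x y := by
    intro x hx y hy
    simp only [hYdef, Finset.mem_filter] at hx hy
    exact h.not_adj_of_anticomplete hG hx.2.1 hy.2.1 hx.2.2 hy.2.2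
  have hcover : t = X ∪ ((t ∩ s) ∪ Y) := by
    ext x
    simp only [hXdef, hYdef, Finset.mem_union, Finset.mem_filter, Finset.mem_inter]
    constructor
    · intro hx
      by_cases hxs : x ∈ s
      · exact Or.inr (Or.inl ⟨hx, hxs⟩)
      · rcases h.complete_or_anticomplete hG hlt hxs with hc | hc
        · exact Or.inl ⟨hx, hxs, hc⟩
        · exact Or.inr (Or.inr ⟨hx, hxs, hc⟩)
    · tauto
  rcases (t ∩ s).eq_empty_or_nonempty with h0 | ⟨w, hw⟩
  · rw [h0, Finset.empty_union] at hcover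
    rw [hcover]
    exact colorableOn_union_of_clique_of_stable hX hY
  have hts : t ∩ s ⊂ s := by
    refine Finset.ssubset_iff_subset_ne.2 ⟨Finset.inter_subset_right, fun heq => ?_⟩
    have h1 : v ∈ t ∩ s := by rw [heq]; exact hv
    simpa using ht (Finset.mem_of_mem_inter_left h1)
  obtain ⟨K, hK, hKc, hKn⟩ := exists_clique_card_eq G (t ∩ s)
  have h1 : 1 ≤ cliqueNumOn G (t ∩ s) := by
    have : ({w} : Finset V).card ≤ cliqueNumOn G (t ∩ s) :=
      card_le_cliqueNumOn (by simpa using hw) (by simp)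
    simpa using this
  have h2 : ColorableOn G ((t ∩ s) ∪ Y) (cliqueNumOn G (t ∩ s)) := by
    refine (h.2 _ hts).1.union_of_not_adj ((colorableOn_one hY).mono h1) ?_
    intro a ha b hb hab
    simp only [hYdef, Finset.mem_filter] at hb
    exact hb.2.2 a (Finset.mem_of_mem_inter_right ha) hab.symm
  have h3 := (colorableOn_card G X).union h2
  rw [← hcover, ← hKn] at h3
  refine h3.mono ?_
  have hXs : ∀ x ∈ X, x ∉ s ∧ ∀ w ∈ s, G.Adj x w := by
    intro x hx
    exact (Finset.mem_filter.1 hx).2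
  rw [← Finset.card_union_of_disjoint]
  · apply card_le_cliqueNumOn
    · exact Finset.union_subset (Finset.filter_subset _ _) (hK.trans Finset.inter_subset_left)
    · intro x hx y hy hxy
      rw [Finset.mem_coe, Finset.mem_union] at hx hy
      rcases hx with hx | hx <;> rcases hy with hy | hy
      · exact hX hx hy hxy
      · exact (hXs x hx).2 y (Finset.mem_of_mem_inter_right (hK hy))
      · exact ((hXs y hy).2 x (Finset.mem_of_mem_inter_right (hK hx))).symm
      · exact hKc hx hy hxy
  · rw [Finset.disjoint_left]
    intro x hx hx'
    exact (hXs x hx).1 (Finset.mem_of_mem_inter_right (hK hx'))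

end IsMinimalObstruction

end MinimalObstruction

/-! ### Finite verification around a five-cycle -/

/-- Adjacency in the five-cycle `0, 1, 2, 3, 4`. -/
def cyc5 (i j : ℕ) : Bool := (i + 1) % 5 == j || (j + 1) % 5 == i

/-- Adjacency in the graph on `0, …, 6` consisting of a five-cycle, a vertex `5` attached to the
cycle vertices in the bit set `m`, and a vertex `6` attached to those in `n`, where `5` and `6` are
adjacent when `e` holds. -/
def adj7 (m n : ℕ) (e : Bool) (x y : ℕ) : Bool :=
  if x < 5 then
    if y < 5 then cyc5 x y else if y == 5 then m.testBit x else n.testBit x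
  else if x == 5 then
    if y < 5 then m.testBit y else e
  else
    if y < 5 then n.testBit y else e

/-- Backtracking search for a colouring of a list of vertices with `k` colours, extending the
partial colouring `acc`, such that no two vertices related by `r` get the same colour. -/
def canColor (r : ℕ → ℕ → Bool) (k : ℕ) : List ℕ → List (ℕ × ℕ) → Bool
  | [], _ => true
  | x :: xs, acc => (List.range k).any fun c =>
      acc.all (fun p => p.2 != c || !r x p.1) && canColor r k xs ((x, c) :: acc)

/-- The induced subgraph on a list `L` of vertices splits into `a` stable sets and
also into `b` cliques. -/
def twoWay (r : ℕ → ℕ → Bool) (L : List ℕ) (a b : ℕ) : Bool :=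
  canColor r a L [] && canColor (fun x y => !r x y) b L []

/-- Lists of vertices together with numbers of stable sets and cliques with too small a sum. -/
def excessData : List (List ℕ × ℕ × ℕ) :=
  ([0, 1, 2, 3, 4, 5, 6], 3, 3) ::
    (List.range 5).flatMap fun i =>
      [((List.range 7).filter (· != i), 2, 3), ((List.range 7).filter (· != i), 3, 2)]

/-- The compatible pairs of attachments to a five-cycle: for each bit set, the bit set of those bit
sets which another vertex may have when it is adjacent (respectively non-adjacent). -/
def compatTable (e : Bool) : List ℕ :=
  if e then
    [4203266176, 2147487744, 2164260864, 2290649480, 2147614720, 2684354560, 3233923264,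
      2160642249, 2147483656, 2147516416, 2281701376, 2290649224, 4026593282, 4026593280,
      3493916865, 2151742153, 2147483712, 2863267856, 3221225472, 2326399113, 2155872256,
      2863267840, 3233857728, 2163869897, 4278190084, 3207200769, 4278190080, 2401897481,
      4144001025, 3072471073, 3578032193, 4294967295]
  else
    [4294967295, 2150251051, 2235829453, 3855, 2154983537, 2150773299, 5570645, 5, 2499821321,
      2147499819, 2231635725, 8392463, 13107, 1073754931, 17, 4194305, 2272723009, 3342387,
      2236941381, 3, 2155282545, 137560115, 5603413, 2049, 84215045, 65537, 621085957, 2097153,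
      257, 67108865, 8193, 1378103]

/-- Whether two vertices attached to a five-cycle along `m` and `n` may be adjacent or
non-adjacent, according to `e`. -/
def compat (m n : ℕ) (e : Bool) : Bool := ((compatTable e).getD m 0).testBit n

theorem compat_or_excess : ∀ e : Bool, ∀ m ∈ List.range 32, ∀ n ∈ List.range 32,
    (compat m n e || excessData.any fun d => twoWay (adj7 m n e) d.1 d.2.1 d.2.2) = true := by
  decide +kernel

/-- Whether vertices with labels `l` and `k` may be adjacent or non-adjacent. Here `i < 5` is the
label of the `i`-th vertex of a five-cycle, and `5 + m` is the label of a vertex attached to the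
cycle along the bit set `m`. -/
def allowed (l k : ℕ) (e : Bool) : Bool :=
  if l < 5 then
    if k < 5 then l != k && cyc5 l k == e else (k - 5).testBit l == e
  else if k < 5 then (l - 5).testBit k == e else compat (l - 5) (k - 5) e

/-- Attachments to a five-cycle with exactly two consecutive neighbours, and possibly the opposite
vertex. -/
def neutralMasks : List ℕ := [3, 6, 12, 24, 17, 11, 22, 13, 26, 21]

/-- The attachments of the twins of the vertex `i` of a five-cycle. -/
def twinMasks (i : ℕ) : List ℕ :=
  [2 ^ ((i + 1) % 5) + 2 ^ ((i + 4) % 5), 2 ^ ((i + 1) % 5) + 2 ^ ((i + 4) % 5) + 2 ^ i]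

def plainLabels : List ℕ :=
  (List.range 37).filter fun l => l != 0 && (l < 5 || !(neutralMasks.contains (l - 5)) &&
    !((twinMasks 0).contains (l - 5)))

theorem not_allowedCycle_plain : ∀ a ∈ plainLabels, ∀ b ∈ plainLabels, allowed a b true = true →
    ∀ c ∈ plainLabels, allowed a c false = true → allowed b c true = true →
    ∀ d ∈ plainLabels, allowed a d false = true → allowed b d false = true →
      allowed c d true = true →
    ∀ e ∈ plainLabels, allowed a e true = true → allowed b e false = true →
      allowed c e false = true → allowed d e true = true → False := by
  decide +kernel

def neutralLabels (n : ℕ) : List ℕ :=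
  (List.range 37).filter fun l => l != 0 && (l < 5 || compat n (l - 5) true ||
    compat n (l - 5) false)

def touches (l i : ℕ) : Bool := if l < 5 then cyc5 l i else (l - 5).testBit i

def backMask (a b c d e i : ℕ) : ℕ :=
  Nat.ofBits fun j : Fin 5 => touches ([a, b, c, d, e].getD j 0) i

/-- Two vertices of the first five-cycle, outside the second one, have incompatible attachments to
the second five-cycle, whose labels are `a, b, c, d, e`. -/
def conflict (a b c d e : ℕ) : Bool :=
  (List.range 5).any fun i => (List.range 5).any fun j =>
    i != j && !([a, b, c, d, e].contains i) && !([a, b, c, d, e].contains j) &&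
      !(compat (backMask a b c d e i) (backMask a b c d e j) (cyc5 i j))

theorem conflict_of_neutral : ∀ n ∈ [12, 13], ∀ a ∈ neutralLabels n, ∀ b ∈ neutralLabels n,
    allowed a b true = true →
    ∀ c ∈ neutralLabels n, allowed a c false = true → allowed b c true = true →
    ∀ d ∈ neutralLabels n, allowed a d false = true → allowed b d false = true →
      allowed c d true = true →
    ∀ e ∈ neutralLabels n, allowed a e true = true → allowed b e false = true →
      allowed c e false = true → allowed d e true = true → conflict a b c d e = true := by
  decide +kernel

theorem allowed_of_neutral_of_not_allowed : ∀ n ∈ [12, 13], ∀ j ∈ [2, 3],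
    ∀ l ∈ neutralLabels n, ∀ k ∈ neutralLabels n,
    allowed l k true = true → allowed l 0 true = true → allowed k 0 true = true →
      allowed l j true = false → allowed k 2 true = true ∧ allowed k 3 true = true := by
  decide +kernel

theorem not_three_twins : ∀ i ∈ List.range 5, ∀ j ∈ List.range 5, ∀ k ∈ List.range 5,
    (i ≠ j ∧ i ≠ k ∧ j ≠ k) → ∀ a ∈ twinMasks i, ∀ b ∈ twinMasks j, ∀ c ∈ twinMasks k,
    ((compat a b true || compat a b false) && (compat a c true || compat a c false) &&
      (compat b c true || compat b c false)) = false := by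
  decide +kernel

/-! ### Soundness of the finite verification -/

theorem exists_coloring_of_canColor {r : ℕ → ℕ → Bool} {k : ℕ} :
    ∀ {L : List ℕ} {acc : List (ℕ × ℕ)}, canColor r k L acc = true → L.Nodup →
      ∃ col : ℕ → ℕ, (∀ x ∈ L, col x < k) ∧
        (∀ x ∈ L, ∀ p ∈ acc, p.2 = col x → r x p.1 = false) ∧
        ∀ x ∈ L, ∀ y ∈ L, x ≠ y → col x = col y → r x y = false ∨ r y x = false
  | [], _, _, _ => ⟨fun _ => 0, by simp, by simp, by simp⟩
  | x :: xs, acc, h, hnd => by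
    simp only [canColor, List.any_eq_true, List.mem_range, Bool.and_eq_true, List.all_eq_true,
      Bool.or_eq_true, bne_iff_ne, Bool.not_eq_true'] at h
    obtain ⟨c, hc, h1, h2⟩ := h
    obtain ⟨hx, hnd⟩ := List.nodup_cons.1 hnd
    obtain ⟨col, h3, h4, h5⟩ := exists_coloring_of_canColor h2 hnd
    have h6 : ∀ y ∈ xs, Function.update col x c y = col y := fun y hy =>
      Function.update_of_ne (fun h => hx (by rwa [← h])) _ _
    have h7 : ∀ y ∈ xs, c = col y → r y x = false := fun y hy hxy =>
      h4 y hy (x, c) List.mem_cons_self hxy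
    refine ⟨Function.update col x c, ?_, ?_, ?_⟩
    · intro y hy
      obtain rfl | hy := List.mem_cons.1 hy
      · simpa using hc
      · rw [h6 y hy]
        exact h3 y hy
    · intro y hy p hp hpy
      obtain rfl | hy := List.mem_cons.1 hy
      · rw [Function.update_self] at hpy
        exact (h1 p hp).resolve_left (not_not.2 hpy)
      · rw [h6 y hy] at hpy
        exact h4 y hy p (List.mem_cons_of_mem _ hp) hpy
    · intro y hy z hz hyz heq
      obtain hyx | hy' := List.mem_cons.1 hy <;> obtain hzx | hz' := List.mem_cons.1 hz
      · exact absurd (hyx.trans hzx.symm) hyz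
      · rw [h6 z hz', hyx, Function.update_self] at heq
        exact Or.inr (hyx ▸ h7 z hz' heq)
      · rw [h6 y hy', hzx, Function.update_self] at heq
        exact Or.inl (hzx ▸ h7 y hy' heq.symm)
      · rw [h6 y hy', h6 z hz'] at heq
        exact h5 y hy' z hz' hyz heq

section FiveCycle

variable {V : Type*} {G : SimpleGraph V}

theorem colorableOn_of_canColor [DecidableEq V] {r : ℕ → ℕ → Bool} {k : ℕ} {L : List ℕ}
    {g : ℕ → V} (h : canColor r k L [] = true) (hnd : L.Nodup)
    (hg : ∀ x ∈ L, ∀ y ∈ L, x ≠ y → g x ≠ g y ∧ (G.Adj (g x) (g y) → r x y = true)) :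
    ColorableOn G (L.toFinset.image g) k := by
  obtain ⟨col, h1, -, h2⟩ := exists_coloring_of_canColor h hnd
  have hinj : ∀ x ∈ L, ∀ y ∈ L, g x = g y → x = y := fun x hx y hy hxy => by
    by_contra hne
    exact (hg x hx y hy hne).1 hxy
  have h3 : ∀ x ∈ L, Function.invFunOn g {y | y ∈ L} (g x) = x := fun x hx => by
    have hmem : ∃ y ∈ {y | y ∈ L}, g y = g x := ⟨x, hx, rfl⟩
    exact hinj _ (Function.invFunOn_mem hmem) _ hx (Function.invFunOn_eq hmem)
  refine ⟨fun v => col (Function.invFunOn g {y | y ∈ L} v), ?_, ?_⟩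
  · intro v hv
    obtain ⟨x, hx, rfl⟩ := Finset.mem_image.1 hv
    have hx := List.mem_toFinset.1 hx
    simpa [h3 x hx] using h1 x hx
  · intro v hv w hw hvw heq
    obtain ⟨x, hx, rfl⟩ := Finset.mem_image.1 hv
    obtain ⟨y, hy, rfl⟩ := Finset.mem_image.1 hw
    have hx := List.mem_toFinset.1 hx
    have hy := List.mem_toFinset.1 hy
    simp only [h3 x hx, h3 y hy] at heq
    have hne : x ≠ y := fun h => hvw.ne (congrArg g h)
    have h4 := (hg x hx y hy hne).2 hvw
    have h5 := (hg y hy x hx hne.symm).2 hvw.symm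
    have h6 := h2 x hx y hy hne heq
    simp [h4, h5] at h6

theorem CoverBound.length_le_of_twoWay (hG : CoverBound G) {r : ℕ → ℕ → Bool} {L : List ℕ}
    {a b : ℕ} {g : ℕ → V} (h : twoWay r L a b = true) (hnd : L.Nodup)
    (hg : ∀ x ∈ L, ∀ y ∈ L, x ≠ y → g x ≠ g y ∧ (G.Adj (g x) (g y) ↔ r x y = true)) :
    L.length ≤ a + b := by
  classical
  rw [twoWay, Bool.and_eq_true] at h
  have h1 := colorableOn_of_canColor (G := G) h.1 hnd fun x hx y hy hxy =>
    ⟨(hg x hx y hy hxy).1, (hg x hx y hy hxy).2.1⟩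
  have h2 := colorableOn_of_canColor (G := Gᶜ) h.2 hnd fun x hx y hy hxy =>
    ⟨(hg x hx y hy hxy).1, fun h => by simpa using fun h' => h.2 ((hg x hx y hy hxy).2.2 h')⟩
  refine le_trans (le_of_eq ?_) (hG _ a b h1 h2)
  rw [Finset.card_image_of_injOn, List.toFinset_card_of_nodup hnd]
  intro x hx y hy hxy
  by_contra hne
  exact (hg x (by simpa using hx) y (by simpa using hy) hne).1 hxy

theorem excessData_spec : ∀ d ∈ excessData,
    d.1.Nodup ∧ (∀ x ∈ d.1, x < 7) ∧ d.2.1 + d.2.2 < d.1.length := by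
  decide

/-- The vertices `c 0, …, c 4` induce a five-cycle, in this order. -/
structure IsFiveCycle_s18 (G : SimpleGraph V) (c : Fin 5 → V) : Prop where
  injective : Function.Injective c
  adj_iff : ∀ i j, G.Adj (c i) (c j) ↔ cyc5 i j = true

open Classical in
/-- The set of neighbours of `u` on `c`, encoded as a bit set. -/
noncomputable def attachment (G : SimpleGraph V) (c : Fin 5 → V) (u : V) : ℕ :=
  Nat.ofBits fun i => decide (G.Adj u (c i))

theorem testBit_attachment (c : Fin 5 → V) (u : V) (i : Fin 5) :
    (attachment G c u).testBit i = true ↔ G.Adj u (c i) := by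
  simp [attachment, Nat.testBit_ofBits_lt]

theorem attachment_lt (c : Fin 5 → V) (u : V) : attachment G c u < 32 :=
  Nat.ofBits_lt_two_pow _

open Classical in
theorem IsFiveCycle_s18.compat (hG : CoverBound G) {c : Fin 5 → V} (hc : IsFiveCycle_s18 G c) {u w : V}
    (hu : u ∉ Set.range c) (hw : w ∉ Set.range c) (huw : u ≠ w) :
    compat (attachment G c u) (attachment G c w) (decide (G.Adj u w)) = true := by
  by_contra hcon
  have h1 := compat_or_excess (decide (G.Adj u w)) (attachment G c u)
    (List.mem_range.2 (attachment_lt c u)) (attachment G c w) (List.mem_range.2 (attachment_lt c w))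
  simp only [Bool.or_eq_true, hcon, false_or, List.any_eq_true] at h1
  obtain ⟨d, hd, h1⟩ := h1
  obtain ⟨h2, h3, h4⟩ := excessData_spec d hd
  refine absurd (hG.length_le_of_twoWay
    (g := fun x => if h : x < 5 then c ⟨x, h⟩ else if x = 5 then u else w) h1 h2 ?_) (by omega)
  intro x hx y hy hxy
  have hu' : ∀ i, c i ≠ u := fun i h => hu ⟨i, h⟩
  have hw' : ∀ i, c i ≠ w := fun i h => hw ⟨i, h⟩
  have h6 : ∀ x < 7, (∃ i : Fin 5, (i : ℕ) = x) ∨ x = 5 ∨ x = 6 := by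
    intro x hx
    by_cases h : x < 5
    · exact Or.inl ⟨⟨x, h⟩, rfl⟩
    · omega
  obtain ⟨i, rfl⟩ | rfl | rfl := h6 x (h3 x hx) <;> obtain ⟨j, rfl⟩ | rfl | rfl := h6 y (h3 y hy)
  · have hij : i ≠ j := fun h => hxy (congrArg _ h)
    simp [adj7, hc.injective.ne hij, hc.adj_iff]
  · simp [adj7, hu', testBit_attachment, G.adj_comm]
  · simp [adj7, hw', testBit_attachment, G.adj_comm]
  · simp [adj7, (hu' _).symm, testBit_attachment]
  · simp at hxy
  · simp [adj7, huw]
  · simp [adj7, (hw' _).symm, testBit_attachment]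
  · simp [adj7, huw.symm, G.adj_comm]
  · simp at hxy

open Classical in
/-- The index of `x` on the five-cycle `c`, or else an encoding of its set of neighbours there. -/
noncomputable def label (G : SimpleGraph V) (c : Fin 5 → V) (x : V) : ℕ :=
  if h : ∃ i, c i = x then h.choose else 5 + attachment G c x

theorem IsFiveCycle_s18.label_apply {c : Fin 5 → V} (hc : IsFiveCycle_s18 G c) (i : Fin 5) :
    label G c (c i) = i := by
  have h : ∃ j, c j = c i := ⟨i, rfl⟩
  rw [label, dif_pos h, hc.injective h.choose_spec]

theorem label_of_notMem {c : Fin 5 → V} {x : V} (hx : x ∉ Set.range c) :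
    label G c x = 5 + attachment G c x :=
  dif_neg hx

theorem label_lt (c : Fin 5 → V) (x : V) : label G c x < 37 := by
  have := attachment_lt (G := G) c x
  unfold label
  split_ifs <;> omega

theorem IsFiveCycle_s18.label_eq_iff {c : Fin 5 → V} (hc : IsFiveCycle_s18 G c) {x : V} {i : Fin 5} :
    label G c x = i ↔ x = c i := by
  constructor
  · intro h
    by_cases hx : x ∈ Set.range c
    · obtain ⟨j, rfl⟩ := hx
      rw [hc.label_apply] at h
      rw [Fin.ext h]
    · rw [label_of_notMem hx] at h
      omega
  · rintro rfl
    exact hc.label_apply i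

open Classical in
theorem IsFiveCycle_s18.allowed (hG : CoverBound G) {c : Fin 5 → V} (hc : IsFiveCycle_s18 G c) {x y : V}
    (hxy : x ≠ y) : allowed (label G c x) (label G c y) (decide (G.Adj x y)) = true := by
  by_cases hx : x ∈ Set.range c <;> by_cases hy : y ∈ Set.range c
  · obtain ⟨i, rfl⟩ := hx
    obtain ⟨j, rfl⟩ := hy
    have hij : (i : ℕ) ≠ j := fun h => hxy (congrArg c (Fin.ext h))
    rw [hc.label_apply, hc.label_apply]
    simp [_root_.allowed, hij, hc.adj_iff]
  · obtain ⟨i, rfl⟩ := hx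
    rw [hc.label_apply, label_of_notMem hy]
    simp only [_root_.allowed, i.2, ↓reduceIte, add_tsub_cancel_left]
    have := testBit_attachment (G := G) c y i
    rw [G.adj_comm] at this
    simp [← this]
  · obtain ⟨j, rfl⟩ := hy
    rw [hc.label_apply, label_of_notMem hx]
    simp only [_root_.allowed, j.2, ↓reduceIte, add_tsub_cancel_left]
    have := testBit_attachment (G := G) c x j
    simp [← this]
  · rw [label_of_notMem hx, label_of_notMem hy]
    simpa [_root_.allowed] using hc.compat hG hx hy hxy

theorem IsFiveCycle_s18.touches_label {c : Fin 5 → V} (hc : IsFiveCycle_s18 G c) (x : V) (i : Fin 5) :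
    touches (label G c x) i = true ↔ G.Adj x (c i) := by
  by_cases hx : x ∈ Set.range c
  · obtain ⟨j, rfl⟩ := hx
    rw [hc.label_apply]
    simp [touches, hc.adj_iff]
  · rw [label_of_notMem hx]
    simp [touches, testBit_attachment]

end FiveCycle

section FiveCycleHitting

variable {V : Type*} {G : SimpleGraph V} {c d : Fin 5 → V}

theorem IsFiveCycle_s18.allowed_cyc5 (hG : CoverBound G) (hc : IsFiveCycle_s18 G c)
    (hd : IsFiveCycle_s18 G d) {i j : Fin 5} (hij : i ≠ j) :
    _root_.allowed (label G c (d i)) (label G c (d j)) (cyc5 i j) = true := by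
  have h := hc.allowed hG (hd.injective.ne hij)
  have h1 := hd.adj_iff i j
  by_cases h2 : cyc5 i j = true
  · rw [h2]
    simpa [h1, h2] using h
  · rw [Bool.not_eq_true] at h2
    rw [h2]
    simpa [h1, h2] using h

/-- A five-cycle without neutral attachments and without twins of `c 0` meets every other one
in `c 0`. -/
theorem IsFiveCycle_s18.exists_eq_of_plain (hG : CoverBound G) (hc : IsFiveCycle_s18 G c)
    (h0 : ∀ x ∉ Set.range c,
      attachment G c x ∉ neutralMasks ∧ attachment G c x ∉ twinMasks 0)
    (hd : IsFiveCycle_s18 G d) : ∃ i, d i = c 0 := by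
  by_contra! hcon
  have hl : ∀ i, label G c (d i) ∈ plainLabels := by
    intro i
    rw [plainLabels, List.mem_filter]
    refine ⟨List.mem_range.2 (label_lt c _), ?_⟩
    have h1 : label G c (d i) ≠ 0 := fun h => hcon i ((hc.label_eq_iff (i := 0)).1 h)
    by_cases hx : d i ∈ Set.range c
    · obtain ⟨j, hj⟩ := hx
      have h2 : label G c (d i) < 5 := by
        rw [← hj, hc.label_apply]
        exact j.2
      simp [h1, h2]
    · have h2 := h0 _ hx
      have h3 := label_of_notMem (G := G) hx
      simp [h3, h2]
  have h : ∀ i j : Fin 5, i ≠ j → _ := fun i j hij => hc.allowed_cyc5 hG hd hij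
  exact not_allowedCycle_plain _ (hl 0) _ (hl 1) (h 0 1 (by decide)) _ (hl 2) (h 0 2 (by decide))
    (h 1 2 (by decide)) _ (hl 3) (h 0 3 (by decide)) (h 1 3 (by decide)) (h 2 3 (by decide))
    _ (hl 4) (h 0 4 (by decide)) (h 1 4 (by decide)) (h 2 4 (by decide)) (h 3 4 (by decide))

theorem label_mem_neutralLabels_self : ∀ n ∈ [12, 13], 5 + n ∈ neutralLabels n := by
  decide +kernel

theorem IsFiveCycle_s18.label_mem_neutralLabels (hG : CoverBound G) (hc : IsFiveCycle_s18 G c) {u : V}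
    (hu : u ∉ Set.range c) (hn : attachment G c u ∈ [12, 13]) {x : V} (hx : x ≠ c 0) :
    label G c x ∈ neutralLabels (attachment G c u) := by
  by_cases hux : u = x
  · subst hux
    rw [label_of_notMem hu]
    exact label_mem_neutralLabels_self _ hn
  rw [neutralLabels, List.mem_filter]
  refine ⟨List.mem_range.2 (label_lt c _), ?_⟩
  have h1 : label G c x ≠ 0 := fun h => hx ((hc.label_eq_iff (i := 0)).1 h)
  by_cases hx : x ∈ Set.range c
  · obtain ⟨j, hj⟩ := hx
    have h2 : label G c x < 5 := by
      rw [← hj, hc.label_apply]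
      exact j.2
    simp [h1, h2]
  · have h2 := hc.compat hG hu hx hux
    have h3 := label_of_notMem (G := G) hx
    by_cases h4 : G.Adj u x
    · simp only [h4, decide_true] at h2
      simp [h3, h2]
    · simp only [h4, decide_false] at h2
      simp [h3, h2]

/-- A five-cycle with an attachment to `c 2`, `c 3` and possibly `c 0` meets every other one
in `c 0`. -/
theorem IsFiveCycle_s18.exists_eq_of_neutral (hG : CoverBound G) (hc : IsFiveCycle_s18 G c) {u : V}
    (hu : u ∉ Set.range c) (hn : attachment G c u ∈ [12, 13]) (hd : IsFiveCycle_s18 G d) :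
    ∃ i, d i = c 0 := by
  classical
  by_contra! hcon
  have hl := fun i => hc.label_mem_neutralLabels hG hu hn (hcon i)
  have h : ∀ i j : Fin 5, i ≠ j → _ := fun i j hij => hc.allowed_cyc5 hG hd hij
  have h1 := conflict_of_neutral _ hn _ (hl 0) _ (hl 1) (h 0 1 (by decide)) _ (hl 2)
    (h 0 2 (by decide)) (h 1 2 (by decide)) _ (hl 3) (h 0 3 (by decide)) (h 1 3 (by decide))
    (h 2 3 (by decide)) _ (hl 4) (h 0 4 (by decide)) (h 1 4 (by decide)) (h 2 4 (by decide))
    (h 3 4 (by decide))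
  rw [conflict] at h1
  set L := [label G c (d 0), label G c (d 1), label G c (d 2), label G c (d 3), label G c (d 4)]
    with hL
  simp only [List.any_eq_true, List.mem_range, Bool.and_eq_true, bne_iff_ne,
    Bool.not_eq_true', List.contains_eq_mem, decide_eq_false_iff_not] at h1
  obtain ⟨i, hi, j, hj, ⟨⟨hij, hiL⟩, hjL⟩, h2⟩ := h1
  have hmem : ∀ t, label G c (d t) ∈ L := by
    intro t
    fin_cases t <;> simp [hL]
  have hout : ∀ i : Fin 5, (i : ℕ) ∉ L → c i ∉ Set.range d := by
    rintro i hi ⟨t, ht⟩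
    apply hi
    rw [← hc.label_apply (G := G) i, ← ht]
    exact hmem t
  have hback : ∀ i : Fin 5, backMask (label G c (d 0)) (label G c (d 1)) (label G c (d 2))
      (label G c (d 3)) (label G c (d 4)) i = attachment G d (c i) := by
    classical
    intro i
    rw [backMask, attachment]
    congr 1
    funext t
    have h3 : [label G c (d 0), label G c (d 1), label G c (d 2), label G c (d 3),
        label G c (d 4)].getD t 0 = label G c (d t) := by
      fin_cases t <;> rfl
    rw [h3, Bool.eq_iff_iff, hc.touches_label, decide_eq_true_iff, G.adj_comm]
  have h3 := hd.compat hG (hout ⟨i, hi⟩ hiL) (hout ⟨j, hj⟩ hjL)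
    (hc.injective.ne fun h => hij (congrArg Fin.val h))
  rw [← hback, ← hback] at h3
  have h4 := hc.adj_iff ⟨i, hi⟩ ⟨j, hj⟩
  rw [show decide (G.Adj (c ⟨i, hi⟩) (c ⟨j, hj⟩)) = cyc5 i j by
    rw [Bool.eq_iff_iff, decide_eq_true_iff, h4]] at h3
  simp [h3] at h2

theorem cyc5_add : ∀ i j k : Fin 5, cyc5 (i + k : Fin 5) (j + k : Fin 5) = cyc5 i j := by
  decide

theorem IsFiveCycle_s18.rotate (hc : IsFiveCycle_s18 G c) (k : Fin 5) :
    IsFiveCycle_s18 G fun i => c (i + k) where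
  injective := fun i j h => add_right_cancel (hc.injective h)
  adj_iff := fun i j => by rw [hc.adj_iff, cyc5_add]

theorem range_rotate (c : Fin 5 → V) (k : Fin 5) :
    Set.range (fun i => c (i + k)) = Set.range c :=
  (Equiv.addRight k).surjective.range_comp c

/-- The attachment to a rotated five-cycle. -/
def rotateMask (k : Fin 5) (m : ℕ) : ℕ := Nat.ofBits fun i : Fin 5 => m.testBit (i + k : Fin 5)

theorem attachment_rotate (c : Fin 5 → V) (k : Fin 5) (u : V) :
    attachment G (fun i => c (i + k)) u = rotateMask k (attachment G c u) := by
  classical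
  rw [attachment, rotateMask]
  congr 1
  funext i
  rw [Bool.eq_iff_iff, testBit_attachment, decide_eq_true_iff]

theorem exists_rotateMask_mem : ∀ m ∈ neutralMasks, ∃ k, rotateMask k m ∈ [12, 13] := by
  decide +kernel

theorem mem_of_rotateMask_mem : ∀ m ∈ List.range 32, ∀ k,
    (rotateMask k m ∈ neutralMasks → m ∈ neutralMasks) ∧
      (rotateMask k m ∈ twinMasks 0 → m ∈ twinMasks k) := by
  decide +kernel

theorem eq_of_mem_twinMasks : ∀ i j : Fin 5, ∀ m ∈ twinMasks i, m ∈ twinMasks j → i = j := by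
  decide +kernel

/-- At most two vertices of a five-cycle have twins. -/
theorem IsFiveCycle_s18.exists_no_twin (hG : CoverBound G) (hc : IsFiveCycle_s18 G c) {S : Finset (Fin 5)}
    (hS : 3 ≤ S.card) :
    ∃ i ∈ S, ∀ x ∉ Set.range c, attachment G c x ∉ twinMasks i := by
  by_contra! hcon
  obtain ⟨i, hi, j, hj, k, hk, hij, hik, hjk⟩ := Finset.two_lt_card.1 hS
  have key : ∀ {x y : V}, x ∉ Set.range c → y ∉ Set.range c → x ≠ y →
      (_root_.compat (attachment G c x) (attachment G c y) true = true ∨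
        _root_.compat (attachment G c x) (attachment G c y) false = true) := by
    intro x y hx hy hxy
    have h := hc.compat hG hx hy hxy
    by_cases h1 : G.Adj x y
    · exact Or.inl (by simpa [h1] using h)
    · exact Or.inr (by simpa [h1] using h)
  obtain ⟨x, hx, hxi⟩ := hcon i hi
  obtain ⟨y, hy, hyj⟩ := hcon j hj
  obtain ⟨z, hz, hzk⟩ := hcon k hk
  have h := not_three_twins i (List.mem_range.2 i.2) j (List.mem_range.2 j.2) k
    (List.mem_range.2 k.2) ⟨Fin.val_injective.ne hij, Fin.val_injective.ne hik,
      Fin.val_injective.ne hjk⟩ _ hxi _ hyj _ hzk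
  have hxy := key hx hy fun h => hij (eq_of_mem_twinMasks i j _ hxi (h ▸ hyj))
  have hxz := key hx hz fun h => hik (eq_of_mem_twinMasks i k _ hxi (h ▸ hzk))
  have hyz := key hy hz fun h => hjk (eq_of_mem_twinMasks j k _ hyj (h ▸ hzk))
  rw [← Bool.not_eq_true] at h
  apply h
  simp only [Bool.and_eq_true, Bool.or_eq_true]
  exact ⟨⟨hxy, hxz⟩, hyz⟩

end FiveCycleHitting

/-! ### Minimal obstructions on five vertices -/

/-- Adjacency in the graph on five vertices given by the upper triangle of its adjacency matrix. -/
def adj5 (a b c d e f g h i j : Bool) : Fin 5 → Fin 5 → Bool :=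
  ![![false, a, b, c, d], ![a, false, e, f, g], ![b, e, false, h, i], ![c, f, h, false, j],
    ![d, g, i, j, false]]

theorem adj5_monochromatic_or_cycle : ∀ a b c d e f g h i j : Bool,
    (∃ x y z, x < y ∧ y < z ∧ adj5 a b c d e f g h i j x y = adj5 a b c d e f g h i j x z ∧
      adj5 a b c d e f g h i j x y = adj5 a b c d e f g h i j y z) ∨
    ∃ p, adj5 a b c d e f g h i j 0 p = true ∧
    ∃ q, adj5 a b c d e f g h i j 0 q = false ∧ adj5 a b c d e f g h i j p q = true ∧
    ∃ r, adj5 a b c d e f g h i j 0 r = false ∧ adj5 a b c d e f g h i j p r = false ∧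
      adj5 a b c d e f g h i j q r = true ∧
    ∃ s, adj5 a b c d e f g h i j 0 s = true ∧ adj5 a b c d e f g h i j p s = false ∧
      adj5 a b c d e f g h i j q s = false ∧ adj5 a b c d e f g h i j r s = true := by
  decide +kernel

theorem eq_of_cyc5_eq : ∀ i j : Fin 5, (∀ k : Fin 5, cyc5 i k = cyc5 j k) → i = j := by
  decide

section FiveVertices

variable {V : Type*} {G : SimpleGraph V}

/-- A graph on five vertices without triangles and stable triples is a five-cycle. -/
theorem exists_isFiveCycle_comp {x : Fin 5 → V}
    (h3 : ∀ i j k, i < j → j < k → ¬ (G.Adj (x i) (x j) ∧ G.Adj (x i) (x k) ∧ G.Adj (x j) (x k)))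
    (h3' : ∀ i j k, i < j → j < k → G.Adj (x i) (x j) ∨ G.Adj (x i) (x k) ∨ G.Adj (x j) (x k)) :
    ∃ σ : Fin 5 → Fin 5, IsFiveCycle_s18 G (x ∘ σ) := by
  classical
  have hadj : ∀ i j, adj5 (decide (G.Adj (x 0) (x 1))) (decide (G.Adj (x 0) (x 2)))
      (decide (G.Adj (x 0) (x 3))) (decide (G.Adj (x 0) (x 4))) (decide (G.Adj (x 1) (x 2)))
      (decide (G.Adj (x 1) (x 3))) (decide (G.Adj (x 1) (x 4))) (decide (G.Adj (x 2) (x 3)))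
      (decide (G.Adj (x 2) (x 4))) (decide (G.Adj (x 3) (x 4))) i j =
        decide (G.Adj (x i) (x j)) := by
    intro i j
    fin_cases i <;> fin_cases j <;> simp [adj5] <;> exact G.adj_comm _ _
  have h := adj5_monochromatic_or_cycle (decide (G.Adj (x 0) (x 1))) (decide (G.Adj (x 0) (x 2)))
      (decide (G.Adj (x 0) (x 3))) (decide (G.Adj (x 0) (x 4))) (decide (G.Adj (x 1) (x 2)))
      (decide (G.Adj (x 1) (x 3))) (decide (G.Adj (x 1) (x 4))) (decide (G.Adj (x 2) (x 3)))
      (decide (G.Adj (x 2) (x 4))) (decide (G.Adj (x 3) (x 4)))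
  simp only [hadj, decide_eq_true_iff, decide_eq_false_iff_not, decide_eq_decide] at h
  obtain ⟨i, j, k, hij, hjk, h1, h2⟩ | ⟨p, h0p, q, h0q, hpq, r, h0r, hpr, hqr, s, h0s, hps, hqs,
    hrs⟩ := h
  · have h4 := h3 i j k hij hjk
    have h5 := h3' i j k hij hjk
    tauto
  · have key : ∀ i j, G.Adj ((x ∘ ![0, p, q, r, s]) i) ((x ∘ ![0, p, q, r, s]) j) ↔
        cyc5 i j = true := by
      intro i j
      fin_cases i <;> fin_cases j <;> simp [cyc5, G.adj_comm] <;>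
        first | assumption | (rw [G.adj_comm]; assumption)
    refine ⟨![0, p, q, r, s], ?_, key⟩
    intro i j hij
    apply eq_of_cyc5_eq
    intro k
    rw [Bool.eq_iff_iff, ← key, ← key, hij]

theorem IsMinimalObstruction.exists_isFiveCycle [DecidableEq V] {s : Finset V}
    (h : IsMinimalObstruction G s)
    (hle : cliqueNumOn G s * cliqueNumOn Gᶜ s ≤ cliqueNumOn G s + cliqueNumOn Gᶜ s) :
    ∃ c : Fin 5 → V, IsFiveCycle_s18 G c ∧ ∀ i, c i ∈ s := by
  have h1 := h.two_le_cliqueNumOn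
  have h2 := h.compl.two_le_cliqueNumOn
  have hcard := h.card_eq
  obtain ⟨a, ha⟩ := Nat.exists_eq_add_of_le h1
  obtain ⟨b, hb⟩ := Nat.exists_eq_add_of_le h2
  rw [ha, hb] at hle
  have ha0 : a = 0 := by nlinarith
  have hb0 : b = 0 := by nlinarith
  subst ha0 hb0
  rw [ha, hb] at hcard
  let x : Fin 5 → V := fun i => (Finset.equivFinOfCardEq hcard).symm i
  have hx : ∀ i, x i ∈ s := fun i => ((Finset.equivFinOfCardEq hcard).symm i).2
  have hinj : Function.Injective x :=
    Subtype.val_injective.comp (Finset.equivFinOfCardEq hcard).symm.injective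
  have htriple : ∀ {H : SimpleGraph V}, cliqueNumOn H s = 2 → ∀ i j k, i < j → j < k →
      ¬ (H.Adj (x i) (x j) ∧ H.Adj (x i) (x k) ∧ H.Adj (x j) (x k)) := by
    rintro H hH i j k hij hjk ⟨hxij, hxik, hxjk⟩
    have h3 : ({x i, x j, x k} : Finset V).card = 3 :=
      Finset.card_eq_three.2 ⟨_, _, _, hxij.ne, hxik.ne, hxjk.ne, rfl⟩
    have h4 : ({x i, x j, x k} : Finset V).card ≤ cliqueNumOn H s := by
      apply card_le_cliqueNumOn
      · intro y hy
        simp only [Finset.mem_insert, Finset.mem_singleton] at hy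
        obtain rfl | rfl | rfl := hy <;> exact hx _
      · simp only [Finset.coe_insert, Finset.coe_singleton]
        simp [isClique_insert, hxij, hxik, hxjk]
    omega
  obtain ⟨σ, hσ⟩ := exists_isFiveCycle_comp (G := G) (x := x) (htriple ha) (by
    intro i j k hij hjk
    by_contra! h3
    exact htriple hb i j k hij hjk ⟨⟨hinj.ne hij.ne, h3.1⟩,
      ⟨hinj.ne (hij.trans hjk).ne, h3.2.1⟩, ⟨hinj.ne hjk.ne, h3.2.2⟩⟩)
  exact ⟨_, hσ, fun i => hx _⟩

end FiveVertices

section Main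

variable {V : Type*} {G : SimpleGraph V} {c : Fin 5 → V}

/-- If all minimal obstructions are small, then deleting a vertex contained in all five-cycles
leaves a perfect graph. -/
theorem perfectOn_erase_of_forall_isFiveCycle [Fintype V] [DecidableEq V]
    (hsmall : ∀ s, IsMinimalObstruction G s →
      cliqueNumOn G s * cliqueNumOn Gᶜ s ≤ cliqueNumOn G s + cliqueNumOn Gᶜ s)
    {v : V} (hv : ∀ d, IsFiveCycle_s18 G d → ∃ i, d i = v) :
    PerfectOn G (Finset.univ.erase v) := by
  apply perfectOn_of_forall_not_isMinimalObstruction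
  intro t ht hmin
  obtain ⟨d, hd, hdt⟩ := hmin.exists_isFiveCycle (hsmall t hmin)
  obtain ⟨i, hi⟩ := hv d hd
  exact Finset.notMem_erase v _ (ht (hi ▸ hdt i))

theorem cliqueNumOn_univ_le_of_notMem [Fintype V] [DecidableEq V] {Q : Finset V} {v : V}
    (hQ : G.IsClique (Q : Set V)) (hcard : cliqueNumOn G Finset.univ ≤ Q.card) (hv : v ∉ Q) :
    cliqueNumOn G (Finset.univ.erase v) = cliqueNumOn G Finset.univ := by
  apply le_antisymm (cliqueNumOn_mono G (Finset.erase_subset _ _))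
  refine hcard.trans (card_le_cliqueNumOn ?_ hQ)
  intro x hx
  exact Finset.mem_erase.2 ⟨fun h => hv (h ▸ hx), Finset.mem_univ x⟩

theorem allowed_true_eq_touches : ∀ l ∈ List.range 37, ∀ j : Fin 5,
    allowed l j true = touches l j := by
  decide +kernel

theorem IsFiveCycle_s18.allowed_label_iff (hc : IsFiveCycle_s18 G c) (x : V) (j : Fin 5) :
    _root_.allowed (label G c x) j true = true ↔ G.Adj x (c j) := by
  rw [allowed_true_eq_touches _ (List.mem_range.2 (label_lt c x)), hc.touches_label]

theorem IsFiveCycle_s18.cliqueNumOn_erase_of_neutral [Fintype V] [DecidableEq V] (hG : CoverBound G)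
    (hc : IsFiveCycle_s18 G c) {u : V} (hu : u ∉ Set.range c) (hn : attachment G c u ∈ [12, 13]) :
    cliqueNumOn G (Finset.univ.erase (c 0)) = cliqueNumOn G Finset.univ := by
  obtain ⟨Q, -, hQ, hcard⟩ := exists_clique_card_eq G Finset.univ
  by_cases h0 : c 0 ∉ Q
  · exact cliqueNumOn_univ_le_of_notMem hQ hcard.ge h0
  rw [not_not] at h0
  have h20 : c 2 ≠ c 0 := hc.injective.ne (by decide)
  have h30 : c 3 ≠ c 0 := hc.injective.ne (by decide)
  have h2 : c 2 ∉ Q := fun h => by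
    have := (hc.adj_iff 2 0).1 (hQ h h0 h20)
    simp [cyc5] at this
  have h3 : c 3 ∉ Q := fun h => by
    have := (hc.adj_iff 3 0).1 (hQ h h0 h30)
    simp [cyc5] at this
  by_cases hall : ∀ x ∈ Q.erase (c 0), G.Adj x (c 2)
  · apply cliqueNumOn_univ_le_of_notMem (Q := insert (c 2) (Q.erase (c 0)))
    · rw [Finset.coe_insert]
      exact (hQ.subset (Finset.coe_subset.2 (Finset.erase_subset _ _))).insert
        fun x hx _ => (hall x hx).symm
    · rw [Finset.card_insert_of_notMem fun h => h2 (Finset.mem_of_mem_erase h),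
        Finset.card_erase_add_one h0, hcard]
    · simp [h20.symm]
  · push Not at hall
    obtain ⟨w, hw, hw2⟩ := hall
    obtain ⟨hw0, hwQ⟩ := Finset.mem_erase.1 hw
    have hall : ∀ x ∈ (Q.erase (c 0)).erase w, G.Adj x (c 2) ∧ G.Adj x (c 3) := by
      classical
      intro x hx
      obtain ⟨hxw, hx⟩ := Finset.mem_erase.1 hx
      obtain ⟨hx0, hxQ⟩ := Finset.mem_erase.1 hx
      have h4 := hc.allowed hG hxw.symm
      rw [decide_eq_true (hQ hwQ hxQ hxw.symm)] at h4
      rw [← hc.allowed_label_iff, Bool.not_eq_true] at hw2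
      have h5 := allowed_of_neutral_of_not_allowed _ hn 2 (by simp) _
        (hc.label_mem_neutralLabels hG hu hn hw0) _ (hc.label_mem_neutralLabels hG hu hn hx0)
        h4 ((hc.allowed_label_iff w 0).2 (hQ hwQ h0 hw0))
        ((hc.allowed_label_iff x 0).2 (hQ hxQ h0 hx0)) hw2
      exact ⟨(hc.allowed_label_iff x 2).1 h5.1, (hc.allowed_label_iff x 3).1 h5.2⟩
    have h23 : G.Adj (c 2) (c 3) := (hc.adj_iff 2 3).2 (by decide)
    have h3' : c 3 ∉ (Q.erase (c 0)).erase w := fun h =>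
      h3 (Finset.mem_of_mem_erase (Finset.mem_of_mem_erase h))
    have h2' : c 2 ∉ insert (c 3) ((Q.erase (c 0)).erase w) := fun h =>
      (Finset.mem_insert.1 h).elim h23.ne fun h =>
        h2 (Finset.mem_of_mem_erase (Finset.mem_of_mem_erase h))
    apply cliqueNumOn_univ_le_of_notMem
      (Q := insert (c 2) (insert (c 3) ((Q.erase (c 0)).erase w)))
    · rw [Finset.coe_insert, Finset.coe_insert]
      refine ((hQ.subset (Finset.coe_subset.2 ((Finset.erase_subset _ _).trans
        (Finset.erase_subset _ _)))).insert fun x hx _ => (hall x hx).2.symm).insert ?_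
      rintro x (rfl | hx) _
      · exact h23
      · exact (hall x hx).1.symm
    · rw [Finset.card_insert_of_notMem h2', Finset.card_insert_of_notMem h3',
        Finset.card_erase_add_one hw, Finset.card_erase_add_one h0, hcard]
    · simp [h20.symm, h30.symm]

theorem three_le_card_compl_of_pairwise_cyc5 : ∀ S : Finset (Fin 5),
    (∀ i ∈ S, ∀ j ∈ S, i ≠ j → cyc5 i j = true) → 3 ≤ Sᶜ.card := by
  decide +kernel

theorem IsFiveCycle_s18.exists_perfectOn_erase [Fintype V] [DecidableEq V] (hG : CoverBound G)
    (hsmall : ∀ s, IsMinimalObstruction G s →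
      cliqueNumOn G s * cliqueNumOn Gᶜ s ≤ cliqueNumOn G s + cliqueNumOn Gᶜ s)
    (hc : IsFiveCycle_s18 G c) :
    ∃ v, PerfectOn G (Finset.univ.erase v) ∧
      cliqueNumOn G (Finset.univ.erase v) = cliqueNumOn G Finset.univ := by
  by_cases hneutral : ∃ u ∉ Set.range c, attachment G c u ∈ neutralMasks
  · obtain ⟨u, hu, hn⟩ := hneutral
    obtain ⟨k, hk⟩ := exists_rotateMask_mem _ hn
    rw [← attachment_rotate] at hk
    rw [← range_rotate c k] at hu
    have hc' := hc.rotate k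
    exact ⟨_, perfectOn_erase_of_forall_isFiveCycle hsmall fun d hd =>
      hc'.exists_eq_of_neutral hG hu hk hd, hc'.cliqueNumOn_erase_of_neutral hG hu hk⟩
  · push Not at hneutral
    obtain ⟨Q, -, hQ, hcard⟩ := exists_clique_card_eq G Finset.univ
    obtain ⟨k, hk, htwin⟩ := hc.exists_no_twin hG (three_le_card_compl_of_pairwise_cyc5
      (Finset.univ.filter fun i => c i ∈ Q) (by
        intro i hi j hj hij
        rw [← hc.adj_iff]
        exact hQ (Finset.mem_filter.1 hi).2 (Finset.mem_filter.1 hj).2 (hc.injective.ne hij)))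
    have hkQ : c k ∉ Q := by simpa using hk
    refine ⟨c k, perfectOn_erase_of_forall_isFiveCycle hsmall fun d hd => ?_,
      cliqueNumOn_univ_le_of_notMem hQ hcard.ge hkQ⟩
    have h := (hc.rotate k).exists_eq_of_plain hG ?_ hd
    · simpa using h
    · intro x hx
      rw [range_rotate] at hx
      rw [attachment_rotate]
      have h1 := mem_of_rotateMask_mem _ (List.mem_range.2 (attachment_lt (G := G) c x)) k
      exact ⟨fun h => hneutral x hx (h1.1 h), fun h => htwin x hx (h1.2 h)⟩

theorem IsMinimalObstruction.exists_perfectOn_erase [Fintype V] [DecidableEq V] {s : Finset V}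
    (h : IsMinimalObstruction G s) (hG : CoverBound G)
    (hlt : cliqueNumOn G s + cliqueNumOn Gᶜ s < cliqueNumOn G s * cliqueNumOn Gᶜ s) :
    ∃ v, PerfectOn G (Finset.univ.erase v) ∧
      cliqueNumOn G (Finset.univ.erase v) = cliqueNumOn G Finset.univ := by
  obtain ⟨Q, -, hQ, hcard⟩ := exists_clique_card_eq G Finset.univ
  have hsQ : ¬ s ⊆ Q := by
    intro hsub
    have h1 := card_le_cliqueNumOn (Finset.Subset.refl s)
      (hQ.subset (Finset.coe_subset.2 hsub))
    rw [h.card_eq] at h1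
    have h2 := h.compl.two_le_cliqueNumOn
    nlinarith
  obtain ⟨v, hv, hvQ⟩ := Finset.not_subset.1 hsQ
  exact ⟨v, h.perfectOn_erase hG hlt hv, cliqueNumOn_univ_le_of_notMem hQ hcard.ge hvQ⟩

theorem CoverBound.exists_perfectOn_erase [Fintype V] [DecidableEq V] (hG : CoverBound G)
    {s : Finset V} (hs : ¬ ColorableOn G s (cliqueNumOn G s)) :
    ∃ v, PerfectOn G (Finset.univ.erase v) ∧
      cliqueNumOn G (Finset.univ.erase v) = cliqueNumOn G Finset.univ := by
  by_cases hsmall : ∀ t, IsMinimalObstruction G t →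
      cliqueNumOn G t * cliqueNumOn Gᶜ t ≤ cliqueNumOn G t + cliqueNumOn Gᶜ t
  · obtain ⟨t, -, ht⟩ := exists_isMinimalObstruction (G := G) (s := s) fun h => hs h.1
    obtain ⟨c, hc, -⟩ := ht.exists_isFiveCycle (hsmall t ht)
    exact hc.exists_perfectOn_erase hG hsmall
  · push Not at hsmall
    obtain ⟨t, ht, hlt⟩ := hsmall
    exact ht.exists_perfectOn_erase hG hlt

end Main

/-- If `G` is `1`-HNG and imperfect, then some vertex `v` can be deleted so that
`G - v` is perfect and has the same clique number as `G`. -/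
theorem stmt_18 {V : Type*} [Fintype V] [DecidableEq V] (G : SimpleGraph V)
    (hG : IsHNG G 1) (hnp : ¬ IsPerfect G) :
    ∃ v : V, IsPerfect (G.induce ({v}ᶜ : Set V)) ∧
      (G.induce ({v}ᶜ : Set V)).cliqueNum = G.cliqueNum := by
  obtain ⟨s, hs⟩ := exists_not_colorableOn hnp
  obtain ⟨v, hv, hcard⟩ := hG.coverBound.exists_perfectOn_erase hs
  refine ⟨v, isPerfect_induce_compl_singleton hv, ?_⟩
  rw [cliqueNum_induce_compl_singleton, cliqueNum_eq_cliqueNumOn_univ, hcard]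
end

section
/- Let G be a finite simple graph that is 1-HNG and whose vertex set is {c1,c2,c3,c4,c5} ∪ D, where c1,...,c5 induce a 5-cycle with edges exactly c1c2, c2c3, c3c4, c4c5, c1c5 and the vertices of D are pairwise nonadjacent. Suppose either (i) every d ∈ D has neighborhood equal to one of {c1}, {c1,c3}, {c1,c4}, {c1,c2,c3,c4,c5}, or (ii) every d ∈ D has neighborhood equal to one of {c1,c2,c4}, {c1,c2,c3,c5} and vertices of both of these neighborhoods occur in D. Then χ(G) = ω(G) + 1. -/
open SimpleGraph

theorem chi_eq_of_colorable {V : Type*} {G : SimpleGraph V} {k : ℕ}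
    (h : G.Colorable (k + 1)) (hn : ¬ G.Colorable k) : chi G = k + 1 := by
  have : G.chromaticNumber = ((k + 1 : ℕ) : ℕ∞) := by
    refine le_antisymm h.chromaticNumber_le ?_
    by_contra hlt
    rw [not_le, Nat.cast_add, Nat.cast_one] at hlt
    exact hn (chromaticNumber_le_iff_colorable.mp (Order.le_of_lt_add_one hlt))
  simp [chi, this]

theorem cliqueNum_eq_of_isNClique {V : Type*} [Fintype V] {G : SimpleGraph V} {k : ℕ}
    {s : Finset V} (hs : G.IsNClique k s) (hf : G.CliqueFree (k + 1)) : G.cliqueNum = k := by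
  refine le_antisymm ?_ ?_
  · obtain ⟨t, ht⟩ := G.exists_isNClique_cliqueNum
    by_contra! hlt
    exact hf.mono hlt t ht
  · rw [← hs.card_eq]
    exact hs.isClique.card_le_cliqueNum

theorem chi_eq_cliqueNum_add_one {V : Type*} [Fintype V] {G : SimpleGraph V} {k : ℕ}
    {s : Finset V} (hs : G.IsNClique k s) (hf : G.CliqueFree (k + 1))
    (h : G.Colorable (k + 1)) (hn : ¬ G.Colorable k) : chi G = G.cliqueNum + 1 := by
  rw [chi_eq_of_colorable h hn, cliqueNum_eq_of_isNClique hs hf]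

/-- If no clique of size `k` avoids the stable set `D`, then there is no clique of size `k + 1`. -/
theorem cliqueFree_succ_of_stable {V : Type*} {G : SimpleGraph V} {D : Set V} {k : ℕ}
    (hD : D.Pairwise fun u v => ¬ G.Adj u v)
    (hf : ∀ s : Finset V, G.IsNClique k s → ∃ v ∈ s, v ∈ D) : G.CliqueFree (k + 1) := by
  classical
  intro s hs
  have erase (v : V) (hv : v ∈ s) : ∃ w ∈ s, w ≠ v ∧ w ∈ D := by
    obtain ⟨w, hw, hwD⟩ := hf (s.erase v) ⟨hs.isClique.subset (by simp),
      by rw [Finset.card_erase_of_mem hv, hs.card_eq, Nat.add_sub_cancel]⟩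
    exact ⟨w, Finset.mem_of_mem_erase hw, Finset.ne_of_mem_erase hw, hwD⟩
  obtain ⟨x, hx⟩ := Finset.card_pos.mp (by rw [hs.card_eq]; omega)
  obtain ⟨u, hu, -, huD⟩ := erase x hx
  obtain ⟨w, hw, hwu, hwD⟩ := erase u hu
  exact hD hwD huD hwu (hs.isClique hw hu hwu)

/-- If `G` is `1`-HNG and consists of an induced `5`-cycle `c1 c2 c3 c4 c5`
together with a stable set `D` of vertices whose neighborhoods are as in case
(i) or case (ii), then `χ(G) = ω(G) + 1`. -/
theorem stmt_19 {V : Type*} [Fintype V] (G : SimpleGraph V)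
    (hG : IsHNG G 1)
    (c1 c2 c3 c4 c5 : V) (D : Set V)
    (hnodup : ([c1, c2, c3, c4, c5] : List V).Nodup)
    (hcover : ({c1, c2, c3, c4, c5} : Set V) ∪ D = Set.univ)
    (hdisj : Disjoint ({c1, c2, c3, c4, c5} : Set V) D)
    (h12 : G.Adj c1 c2) (h23 : G.Adj c2 c3) (h34 : G.Adj c3 c4) (h45 : G.Adj c4 c5)
    (h15 : G.Adj c1 c5)
    (h13 : ¬ G.Adj c1 c3) (h14 : ¬ G.Adj c1 c4) (h24 : ¬ G.Adj c2 c4)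
    (h25 : ¬ G.Adj c2 c5) (h35 : ¬ G.Adj c3 c5)
    (hDindep : D.Pairwise fun u v => ¬ G.Adj u v)
    (hcase :
      (∀ d ∈ D, G.neighborSet d = {c1} ∨ G.neighborSet d = {c1, c3} ∨
        G.neighborSet d = {c1, c4} ∨ G.neighborSet d = {c1, c2, c3, c4, c5}) ∨
      ((∀ d ∈ D, G.neighborSet d = {c1, c2, c4} ∨
          G.neighborSet d = {c1, c2, c3, c5}) ∧
        (∃ d ∈ D, G.neighborSet d = {c1, c2, c4}) ∧
        (∃ d ∈ D, G.neighborSet d = {c1, c2, c3, c5}))) :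
    chi G = G.cliqueNum + 1 := by
  classical
  have hmem (v : V) (hv : v ∉ D) : v = c1 ∨ v = c2 ∨ v = c3 ∨ v = c4 ∨ v = c5 := by
    have : v ∈ ({c1, c2, c3, c4, c5} : Set V) ∪ D := hcover ▸ Set.mem_univ v
    simpa [hv] using this
  have hc : c1 ∉ D ∧ c2 ∉ D ∧ c3 ∉ D ∧ c4 ∉ D ∧ c5 ∉ D := by
    refine ⟨?_, ?_, ?_, ?_, ?_⟩ <;> exact Set.disjoint_left.mp hdisj (by simp)
  obtain ⟨hc1, hc2, hc3, hc4, hc5⟩ := hc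
  simp only [List.nodup_cons, List.mem_cons, List.not_mem_nil, not_or, or_false] at hnodup
  have htri (a b c : V) (ha : a ∉ D) (hb : b ∉ D) (hc : c ∉ D)
      (hab : G.Adj a b) (hac : G.Adj a c) (hbc : G.Adj b c) : False := by
    rcases hmem a ha with rfl | rfl | rfl | rfl | rfl <;>
    rcases hmem b hb with rfl | rfl | rfl | rfl | rfl <;>
    first
    | exact G.loopless.irrefl _ hab
    | exact h13 hab | exact h13 hab.symm | exact h14 hab | exact h14 hab.symm
    | exact h24 hab | exact h24 hab.symm | exact h25 hab | exact h25 hab.symm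
    | exact h35 hab | exact h35 hab.symm
    | rcases hmem c hc with rfl | rfl | rfl | rfl | rfl <;>
      simp_all [G.adj_comm]
  have hfree4 : G.CliqueFree 4 := by
    refine cliqueFree_succ_of_stable hDindep fun s hs => ?_
    obtain ⟨a, b, c, hab, hac, hbc, rfl⟩ := is3Clique_iff.mp hs
    by_contra! hno
    exact htri a b c (hno a (by simp)) (hno b (by simp)) (hno c (by simp)) hab hac hbc
  obtain ⟨h12', h13', h14', h15'⟩ := hnodup.1
  obtain ⟨h23', h24', h25'⟩ := hnodup.2.1
  obtain ⟨h34', h35'⟩ := hnodup.2.2.1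
  have h45' := hnodup.2.2.2.1
  obtain ⟨f, hf1, hf2, hf3, hf4, hf5, hfD⟩ : ∃ f : V → Fin 3,
      f c1 = 0 ∧ f c2 = 1 ∧ f c3 = 0 ∧ f c4 = 1 ∧ f c5 = 2 ∧ ∀ d ∈ D, f d = 2 := by
    refine ⟨fun v => if v = c1 ∨ v = c3 then 0 else if v = c2 ∨ v = c4 then 1 else 2,
      ?_, ?_, ?_, ?_, ?_, fun d hd => ?_⟩
    · simp
    · simp [Ne.symm h12', h23']
    · simp
    · simp [Ne.symm h14', Ne.symm h34']
    · simp [Ne.symm h15', Ne.symm h25', Ne.symm h35', Ne.symm h45']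
    · have hne : d ≠ c1 ∧ d ≠ c2 ∧ d ≠ c3 ∧ d ≠ c4 := by
        refine ⟨?_, ?_, ?_, ?_⟩ <;> rintro rfl <;> contradiction
      simp [hne]
  have hf (u v : V) (hu : u ∉ D) (hv : v ∉ D) (huv : G.Adj u v) : f u ≠ f v := by
    rcases hmem u hu with rfl | rfl | rfl | rfl | rfl <;>
    rcases hmem v hv with rfl | rfl | rfl | rfl | rfl <;>
    first
    | exact absurd huv (G.loopless.irrefl _)
    | exact absurd huv h13
    | exact absurd huv.symm h13
    | exact absurd huv h24
    | exact absurd huv.symm h24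
    | simp only [hf1, hf2, hf3, hf4, hf5]; decide
  have hcol4 : G.Colorable 4 := by
    refine ⟨Coloring.mk (fun v => if v ∈ D then 3 else (f v).castSucc) fun {u v} huv => ?_⟩
    by_cases hu : u ∈ D <;> by_cases hv : v ∈ D
    · exact absurd huv (hDindep hu hv huv.ne)
    · simpa [hu, hv] using (Fin.castSucc_lt_last (f v)).ne'
    · simpa [hu, hv] using (Fin.castSucc_lt_last (f u)).ne
    · simpa [hu, hv] using hf u v hu hv huv
  have h3clique (d : V) (h1 : G.Adj d c1) (h2 : G.Adj d c2) : G.IsNClique 3 {d, c1, c2} :=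
    is3Clique_triple_iff.mpr ⟨h1, h2, h12⟩
  rcases hcase with hi | ⟨hii, ⟨d, hd, hdn⟩, ⟨e, he, hen⟩⟩
  · by_cases hall : ∃ d ∈ D, G.neighborSet d = {c1, c2, c3, c4, c5}
    · obtain ⟨d, hd, hdn⟩ := hall
      have hadj (v : V) (hv : v ∈ ({c1, c2, c3, c4, c5} : Set V)) : G.Adj d v := by
        rwa [← hdn] at hv
      have hd1 := hadj c1 (by simp)
      have hd2 := hadj c2 (by simp)
      have hd3 := hadj c3 (by simp)
      have hd4 := hadj c4 (by simp)
      have hd5 := hadj c5 (by simp)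
      refine chi_eq_cliqueNum_add_one (h3clique d hd1 hd2) hfree4 hcol4 fun ⟨C⟩ => ?_
      have := C.valid h12
      have := C.valid h23
      have := C.valid h34
      have := C.valid h45
      have := C.valid h15
      have := C.valid hd1
      have := C.valid hd2
      have := C.valid hd3
      have := C.valid hd4
      have := C.valid hd5
      omega
    · have hsub (d : V) (hd : d ∈ D) :
          (∀ v, G.Adj d v → v = c1 ∨ v = c3) ∨ (∀ v, G.Adj d v → v = c1 ∨ v = c4) := by
        simp only [← mem_neighborSet]
        rcases hi d hd with h | h | h | h
        · simp +contextual [h]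
        · simp [h]
        · simp [h]
        · exact absurd ⟨d, hd, h⟩ hall
      have htriD (d v w : V) (hd : d ∈ D) (hv : G.Adj d v) (hw : G.Adj d w)
          (hvw : G.Adj v w) : False := by
        rcases hsub d hd with h | h <;>
        rcases h v hv with rfl | rfl <;>
        rcases h w hw with rfl | rfl <;>
        simp_all [G.adj_comm]
      have hfree3 : G.CliqueFree 3 := by
        intro s hs
        obtain ⟨a, b, c, hab, hac, hbc, rfl⟩ := is3Clique_iff.mp hs
        by_cases ha : a ∈ D
        · exact htriD a b c ha hab hac hbc
        by_cases hb : b ∈ D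
        · exact htriD b a c hb hab.symm hbc hac
        by_cases hc : c ∈ D
        · exact htriD c a b hc hac.symm hbc.symm hab
        exact htri a b c ha hb hc hab hac hbc
      have hcol3 : G.Colorable 3 := by
        have hfD' (u v : V) (hu : u ∈ D) (huv : G.Adj u v) : f u ≠ f v := by
          rw [hfD u hu]
          have hv : v = c1 ∨ v = c3 ∨ v = c4 := by
            rcases hsub u hu with h | h <;> have := h v huv <;> tauto
          rcases hv with rfl | rfl | rfl <;> simp [hf1, hf3, hf4]
        refine ⟨Coloring.mk f fun {u v} huv => ?_⟩
        by_cases hu : u ∈ D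
        · exact hfD' u v hu huv
        by_cases hv : v ∈ D
        · exact (hfD' v u hv huv.symm).symm
        exact hf u v hu hv huv
      have h2clique : G.IsNClique 2 {c1, c2} := by
        refine ⟨?_, Finset.card_pair h12.ne⟩
        simp [isClique_iff, h12]
      refine chi_eq_cliqueNum_add_one h2clique hfree3 hcol3 fun ⟨C⟩ => ?_
      have := C.valid h12
      have := C.valid h23
      have := C.valid h34
      have := C.valid h45
      have := C.valid h15
      omega
  · have hadj (v : V) (hv : v ∈ ({c1, c2, c4} : Set V)) : G.Adj d v := by
      rwa [← hdn] at hv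
    have hadj' (v : V) (hv : v ∈ ({c1, c2, c3, c5} : Set V)) : G.Adj e v := by
      rwa [← hen] at hv
    have hd1 := hadj c1 (by simp)
    have hd2 := hadj c2 (by simp)
    refine chi_eq_cliqueNum_add_one (h3clique d hd1 hd2) hfree4 hcol4 fun ⟨C⟩ => ?_
    have := C.valid h12
    have := C.valid h23
    have := C.valid h34
    have := C.valid h45
    have := C.valid h15
    have := C.valid hd1
    have := C.valid hd2
    have := C.valid (hadj c4 (by simp))
    have := C.valid (hadj' c1 (by simp))
    have := C.valid (hadj' c2 (by simp))
    have := C.valid (hadj' c3 (by simp))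
    have := C.valid (hadj' c5 (by simp))
    omega
end
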